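/- arXiv:math/0004145 — 4 statements merged into one kernel-verified Lean document; each statement's English description precedes it below -/
import Mathlib

section
/- Let X and Y be Banach spaces and let T : X → Y be a strictly integral operator. If Y has the compact range property (CRP), then T is a compact operator. -/
open MeasureTheory ENNReal

/-- A vector measure has bounded variation if the sums `∑ ‖ν sᵢ‖` over finite families of
pairwise disjoint measurable sets are uniformly bounded. -/
def BoundedVariationVM {α : Type*} [MeasurableSpace α] {E : Type*} [NormedAddCommGroup E]
    (ν : VectorMeasure α E) : Prop :=
  ∃ C : ℝ, ∀ (n : ℕ) (s : Fin n → Set α), (∀ i, MeasurableSet (s i)) →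
    Pairwise (Function.onFun Disjoint s) → ∑ i, ‖ν (s i)‖ ≤ C

/-- A Banach space `E` has the compact range property (CRP) if every countably additive
`E`-valued vector measure of bounded variation has relatively norm-compact range. -/
def HasCRP (E : Type*) [NormedAddCommGroup E] : Prop :=
  ∀ (α : Type) (_ : MeasurableSpace α) (ν : VectorMeasure α E),
    BoundedVariationVM ν → IsCompact (closure (Set.range ν))

/-- `T : X → Y` is strictly integral if it factors as `β ∘ J ∘ α` through the natural
inclusion `J : L^∞(μ) → L^1(μ)` for some probability measure `μ`. -/
def StrictlyIntegral {X Y : Type*} [NormedAddCommGroup X] [NormedSpace ℂ X]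
    [NormedAddCommGroup Y] [NormedSpace ℂ Y] (T : X →L[ℂ] Y) : Prop :=
  ∃ (Ω : Type) (_ : MeasurableSpace Ω) (μ : Measure Ω) (_ : IsProbabilityMeasure μ)
    (J : Lp ℂ ∞ μ →L[ℂ] Lp ℂ 1 μ) (A : X →L[ℂ] Lp ℂ ∞ μ) (B : Lp ℂ 1 μ →L[ℂ] Y),
      (∀ f : Lp ℂ ∞ μ, ((J f : Lp ℂ 1 μ) : Ω →ₘ[μ] ℂ) = ((f : Lp ℂ ∞ μ) : Ω →ₘ[μ] ℂ)) ∧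
      T = B.comp (J.comp A)


namespace CRPProof

open Classical in
/-- `B` applied to the class of `f`, or `0` if `f` is not integrable. -/
noncomputable def G {Ω Y : Type*} [MeasurableSpace Ω] {μ : Measure Ω}
    [NormedAddCommGroup Y] [NormedSpace ℂ Y] (B : Lp ℂ 1 μ →L[ℂ] Y) (f : Ω → ℂ) : Y :=
  if h : Integrable f μ then B (h.toL1 f) else 0

section
variable {Ω Y : Type*} [MeasurableSpace Ω] {μ : Measure Ω}
    [NormedAddCommGroup Y] [NormedSpace ℂ Y] (B : Lp ℂ 1 μ →L[ℂ] Y)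

lemma G_add {f g : Ω → ℂ} (hf : Integrable f μ) (hg : Integrable g μ) :
    G B (f + g) = G B f + G B g := by
  simp only [G, hf, hg, hf.add hg, dif_pos]
  rw [← map_add, Integrable.toL1_add]

lemma G_smul {f : Ω → ℂ} (hf : Integrable f μ) (c : ℂ) :
    G B (c • f) = c • G B f := by
  simp only [G, hf, hf.smul c, dif_pos]
  rw [← map_smul, Integrable.toL1_smul']

lemma G_sub {f g : Ω → ℂ} (hf : Integrable f μ) (hg : Integrable g μ) :
    G B (f - g) = G B f - G B g := by
  simp only [G, hf, hg, hf.sub hg, dif_pos]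
  rw [← map_sub, Integrable.toL1_sub]

lemma G_zero : G B (0 : Ω → ℂ) = 0 := by
  have := G_smul B (integrable_zero Ω ℂ μ) 0
  simpa using this

lemma G_sum {ι : Type*} (s : Finset ι) (f : ι → Ω → ℂ) (hf : ∀ i, Integrable (f i) μ) :
    G B (∑ i ∈ s, f i) = ∑ i ∈ s, G B (f i) := by
  classical
  induction s using Finset.induction_on with
  | empty => simpa using G_zero B
  | insert a s ha ih =>
    rw [Finset.sum_insert ha, Finset.sum_insert ha, G_add B (hf a), ih]
    exact integrable_finsetSum' _ fun i _ => hf i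

lemma G_enorm_le (f : Ω → ℂ) : ‖G B f‖ₑ ≤ ‖B‖ₑ * ∫⁻ x, ‖f x‖ₑ ∂μ := by
  by_cases h : Integrable f μ
  · simp only [G, h, dif_pos]
    rw [← Integrable.enorm_toL1 h]
    exact B.le_opENorm _
  · simp [G, h]

lemma ind_int [IsFiniteMeasure μ] {s : Set Ω} (hs : MeasurableSet s) :
    Integrable (s.indicator (fun _ => (1 : ℂ))) μ :=
  (integrable_const _).indicator hs

open Classical in
/-- The vector measure associated with `B`. -/
noncomputable def vm [IsFiniteMeasure μ] : VectorMeasure Ω Y :=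
  VectorMeasure.of_additive_of_le_measure
    (fun s => if MeasurableSet s then G B (s.indicator (fun _ => (1 : ℂ))) else 0)
    (μ := ‖B‖₊ • μ)
    (by
      intro s
      by_cases hs : MeasurableSet s
      · simp only [hs, if_true]
        refine (G_enorm_le B _).trans ?_
        have : ∀ x, ‖s.indicator (fun _ => (1 : ℂ)) x‖ₑ = s.indicator 1 x := by
          intro x; by_cases hx : x ∈ s <;> simp [hx]
        simp only [this]
        rw [lintegral_indicator_one hs]
        rw [Measure.smul_apply, ENNReal.smul_def, smul_eq_mul]
        rfl
      · simp [hs])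
    (by
      intro s t hs ht hd
      simp only [hs, ht, hs.union ht, if_true]
      rw [← G_add B (ind_int hs) (ind_int ht)]
      congr 1
      exact Set.indicator_union_of_disjoint hd _)
    (by
      intro s hs
      simp [hs])

lemma vm_apply [IsFiniteMeasure μ] {s : Set Ω} (hs : MeasurableSet s) :
    vm B s = G B (s.indicator (fun _ => (1 : ℂ))) := by
  classical
  have : vm B s = if MeasurableSet s then G B (s.indicator (fun _ => (1 : ℂ))) else 0 := by
    change @ite _ (MeasurableSet s) (Classical.propDecidable _) _ _ = _
    simp [hs]
  simpa [hs] using this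

lemma vm_norm_le [IsFiniteMeasure μ] {s : Set Ω} (hs : MeasurableSet s) :
    ‖vm B s‖ ≤ ‖B‖ * μ.real s := by
  have h := G_enorm_le B (s.indicator (fun _ => (1 : ℂ)))
  have : ∀ x, ‖s.indicator (fun _ => (1 : ℂ)) x‖ₑ = s.indicator 1 x := by
    intro x; by_cases hx : x ∈ s <;> simp [hx]
  simp only [this] at h
  rw [lintegral_indicator_one hs, ← vm_apply B hs] at h
  have h2 := ENNReal.toReal_mono (by finiteness) h
  simpa [ENNReal.toReal_mul, Measure.real] using h2

lemma vm_bv [IsFiniteMeasure μ] : BoundedVariationVM (vm B) := by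
  refine ⟨‖B‖ * μ.real Set.univ, fun n s hs hd => ?_⟩
  calc ∑ i, ‖vm B (s i)‖ ≤ ∑ i, ‖B‖ * μ.real (s i) :=
        Finset.sum_le_sum fun i _ => vm_norm_le B (hs i)
    _ = ‖B‖ * ∑ i, μ.real (s i) := by rw [Finset.mul_sum]
    _ ≤ _ := by
      gcongr
      exact sum_measureReal_le_measureReal_univ (fun i _ => hs i)
        (fun i _ j _ hij => hd hij)

/-- Integrability of bounded measurable real functions, seen as complex functions. -/
lemma real_int [IsFiniteMeasure μ] {f : Ω → ℝ} (hf : Measurable f) (h0 : ∀ x, 0 ≤ f x)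
    (h1 : ∀ x, f x ≤ 1) : Integrable (fun x => (f x : ℂ)) μ := by
  refine Integrable.of_bound (Complex.measurable_ofReal.comp hf).aestronglyMeasurable 1 ?_
  filter_upwards with x
  simp [abs_of_nonneg (h0 x), h1 x]

lemma sum_floor (n : ℕ) (t : ℝ) (h0 : 0 ≤ t) (h1 : t ≤ n) :
    ∑ k ∈ Finset.range n, (if (k : ℝ) + 1 ≤ t then (1 : ℝ) else 0) = (⌊t⌋₊ : ℝ) := by
  rw [Finset.sum_boole]
  congr 1
  have : Finset.filter (fun k : ℕ => (k : ℝ) + 1 ≤ t) (Finset.range n) = Finset.range ⌊t⌋₊ := by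
    ext k
    simp only [Finset.mem_filter, Finset.mem_range]
    rw [← Nat.succ_le_iff (n := ⌊t⌋₊), Nat.le_floor_iff h0]
    push_cast
    constructor
    · exact fun h => h.2
    · intro h
      refine ⟨?_, h⟩
      have : (k : ℝ) < n := by linarith
      exact_mod_cast this
  rw [this, Finset.card_range]

lemma real_mem [IsProbabilityMeasure μ] {f : Ω → ℝ} (hf : Measurable f) (h0 : ∀ x, 0 ≤ f x)
    (h1 : ∀ x, f x ≤ 1) :
    G B (fun x => (f x : ℂ)) ∈ closure (convexHull ℝ (Set.range (vm B))) := by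
  rw [Metric.mem_closure_iff]
  intro ε hε
  obtain ⟨m, hm⟩ := exists_nat_gt (‖B‖ / ε)
  set n := m + 1 with hn
  have hnpos : (0 : ℝ) < n := by positivity
  have hBn : ‖B‖ * (1 / n) < ε := by
    rw [mul_one_div, div_lt_iff₀ hnpos, hn]
    rw [div_lt_iff₀ hε] at hm
    push_cast
    nlinarith
  let S : ℕ → Set Ω := fun k => {x | (k : ℝ) + 1 ≤ n * f x}
  have hS : ∀ k, MeasurableSet (S k) := fun k =>
    measurableSet_le measurable_const (hf.const_mul _)
  let F : Ω → ℂ := ∑ k ∈ Finset.range n, ((1 / n : ℝ) : ℂ) • (S k).indicator (fun _ => (1 : ℂ))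
  have hFi : Integrable F μ := integrable_finsetSum' _ fun k _ => (ind_int (hS k)).smul _
  have hGF : G B F = ∑ k ∈ Finset.range n, (1 / n : ℝ) • vm B (S k) := by
    rw [G_sum B _ _ fun k => (ind_int (hS k)).smul _]
    refine Finset.sum_congr rfl fun k _ => ?_
    rw [G_smul B (ind_int (hS k)), vm_apply B (hS k)]
    exact Complex.coe_smul _ _
  have hF : ∀ x, F x = ((⌊n * f x⌋₊ / n : ℝ) : ℂ) := by
    intro x
    rw [← sum_floor n (n * f x) (mul_nonneg hnpos.le (h0 x))
      (by nlinarith [h1 x])]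
    simp only [F, Finset.sum_apply, Pi.smul_apply, smul_eq_mul]
    rw [← Finset.mul_sum, Finset.sum_div, ← Finset.sum_div]
    push_cast
    rw [one_div, div_eq_mul_inv, mul_comm]
    congr 1
    refine Finset.sum_congr rfl fun k _ => ?_
    by_cases hk : (k : ℝ) + 1 ≤ n * f x
    · have : x ∈ S k := hk
      simp [this, hk]
    · have : x ∉ S k := hk
      simp [this, hk]
  refine ⟨G B F, ?_, ?_⟩
  · rw [hGF]
    refine (convex_convexHull ℝ _).sum_mem (fun _ _ => by positivity) ?_
      (fun k _ => subset_convexHull ℝ _ ⟨S k, rfl⟩)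
    simp [hnpos.ne']
  · rw [dist_eq_norm, ← G_sub B (real_int hf h0 h1) hFi]
    refine lt_of_le_of_lt ?_ hBn
    have hle : ‖G B ((fun x => (f x : ℂ)) - F)‖ₑ ≤ ‖B‖ₑ * ENNReal.ofReal (1 / n) := by
      refine (G_enorm_le B _).trans ?_
      gcongr
      calc ∫⁻ x, ‖((fun x => (f x : ℂ)) - F) x‖ₑ ∂μ ≤ ∫⁻ x, ENNReal.ofReal (1 / n) ∂μ := by
            refine lintegral_mono fun x => ?_
            rw [← ofReal_norm]
            refine ENNReal.ofReal_le_ofReal ?_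
            rw [Pi.sub_apply, hF, ← Complex.ofReal_sub, Complex.norm_real, Real.norm_eq_abs]
            have a1 := Nat.floor_le (mul_nonneg hnpos.le (h0 x))
            have a2 := Nat.lt_floor_add_one (n * f x)
            have e : f x - ⌊n * f x⌋₊ / n = (n * f x - ⌊n * f x⌋₊) / n := by
              field_simp
            rw [e, abs_of_nonneg (div_nonneg (by linarith) hnpos.le)]
            gcongr
            linarith
        _ = _ := by simp
    have h2 := ENNReal.toReal_mono (by finiteness) hle
    rw [ENNReal.toReal_mul, ENNReal.toReal_ofReal (by positivity)] at h2
    simpa using h2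

/-- truncation to the unit interval -/
noncomputable def tr (t : ℝ) : ℝ := max 0 (min 1 t)

lemma tr_meas : Measurable tr := by unfold tr; fun_prop
lemma tr_nonneg (t : ℝ) : 0 ≤ tr t := le_max_left _ _
lemma tr_le (t : ℝ) : tr t ≤ 1 := max_le zero_le_one (min_le_left _ _)
lemma tr_sub {t : ℝ} (h : |t| ≤ 1) : tr t - tr (-t) = t := by
  rw [abs_le] at h
  unfold tr
  rw [min_eq_right h.2, min_eq_right (by linarith)]
  rcases le_total 0 t with h | h
  · rw [max_eq_right h, max_eq_left (by linarith)]; ring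
  · rw [max_eq_left h, max_eq_right (by linarith)]; ring

lemma G_congr {f g : Ω → ℂ} (hf : Integrable f μ) (h : f =ᵐ[μ] g) : G B f = G B g := by
  simp only [G, hf, hf.congr h, dif_pos]
  congr 1
  exact (Integrable.toL1_eq_toL1_iff _ _ _ _).2 h

lemma decomp [IsProbabilityMeasure μ] {K : Set Y}
    (hK : K = closure (convexHull ℝ (Set.range (vm B))))
    {g : Ω → ℂ} (hg : Measurable g) (hb : ∀ᵐ x ∂μ, ‖g x‖ ≤ 1) :
    ∃ a ∈ K, ∃ b ∈ K, ∃ c ∈ K, ∃ d ∈ K, G B g = (a - b) + Complex.I • (c - d) := by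
  have key : ∀ u : Ω → ℝ, Measurable u → G B (fun x => (tr (u x) : ℂ)) ∈ K ∧
      Integrable (fun x => (tr (u x) : ℂ)) μ := by
    intro u hu
    refine ⟨hK ▸ real_mem B (tr_meas.comp hu) (fun x => tr_nonneg _) (fun x => tr_le _),
      real_int (tr_meas.comp hu) (fun x => tr_nonneg _) (fun x => tr_le _)⟩
  have hre : Measurable fun x => (g x).re := Complex.measurable_re.comp hg
  have him : Measurable fun x => (g x).im := Complex.measurable_im.comp hg
  obtain ⟨m1, i1⟩ := key _ hre
  obtain ⟨m2, i2⟩ := key _ hre.neg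
  obtain ⟨m3, i3⟩ := key _ him
  obtain ⟨m4, i4⟩ := key _ him.neg
  refine ⟨_, m1, _, m2, _, m3, _, m4, ?_⟩
  rw [← G_sub B i1 i2, ← G_sub B i3 i4, ← G_smul B (i3.sub i4),
    ← G_add B (i1.sub i2) ((i3.sub i4).smul _)]
  refine G_congr B (Integrable.of_bound hg.aestronglyMeasurable 1 hb) ?_
  filter_upwards [hb] with x hx
  have h1 := tr_sub ((Complex.abs_re_le_norm (g x)).trans hx)
  have h2 := tr_sub ((Complex.abs_im_le_norm (g x)).trans hx)
  simp only [Pi.add_apply, Pi.sub_apply, Pi.smul_apply, smul_eq_mul, Pi.neg_apply]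
  rw [← Complex.ofReal_sub, ← Complex.ofReal_sub, h1, h2, mul_comm]
  exact (Complex.re_add_im _).symm

end

end CRPProof

/-- If `T : X → Y` is strictly integral and `Y` has the compact range property,
then `T` is a compact operator. -/
theorem strictlyIntegral_isCompactOperator_of_hasCRP
    {X Y : Type*} [NormedAddCommGroup X] [NormedSpace ℂ X] [CompleteSpace X]
    [NormedAddCommGroup Y] [NormedSpace ℂ Y] [CompleteSpace Y]
    (T : X →L[ℂ] Y) (hT : StrictlyIntegral T) (hY : HasCRP Y) :
    IsCompactOperator T := by
  obtain ⟨Ω, _, μ, _, J, A, B, hJ, rfl⟩ := hT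
  have hc := hY Ω _ (CRPProof.vm B) (CRPProof.vm_bv B)
  have htb : TotallyBounded (convexHull ℝ (Set.range (CRPProof.vm B))) :=
    (hc.totallyBounded.subset subset_closure).convexHull
  obtain ⟨K, hK⟩ : ∃ K, K = closure (convexHull ℝ (Set.range (CRPProof.vm B))) := ⟨_, rfl⟩
  have hKc : IsCompact K := by
    rw [hK]
    exact isCompact_iff_totallyBounded_isComplete.2 ⟨htb.closure, isClosed_closure.isComplete⟩
  have hcomp : IsCompact ((fun p : (Y × Y) × (Y × Y) =>
      (p.1.1 - p.1.2) + Complex.I • (p.2.1 - p.2.2)) '' ((K ×ˢ K) ×ˢ (K ×ˢ K))) :=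
    ((hKc.prod hKc).prod (hKc.prod hKc)).image (by fun_prop)
  refine ⟨_, hcomp, ?_⟩
  have hnb : A ⁻¹' Metric.ball 0 1 ∈ nhds (0 : X) := by
    apply A.continuous.continuousAt.preimage_mem_nhds
    rw [map_zero]
    exact Metric.ball_mem_nhds _ one_pos
  filter_upwards [hnb] with x hx
  have hx1 : ‖A x‖ ≤ 1 := by
    have : A x ∈ Metric.ball 0 1 := hx
    exact (mem_ball_zero_iff.1 this).le
  have hb : ∀ᵐ w ∂μ, ‖(J (A x) : Ω → ℂ) w‖ ≤ 1 := by
    have e : (J (A x) : Ω → ℂ) = (A x : Ω → ℂ) := by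
      change ((J (A x) : Lp ℂ 1 μ) : Ω →ₘ[μ] ℂ).cast = _
      rw [hJ]
    rw [e]
    filter_upwards [ae_le_eLpNormEssSup (f := (A x : Ω → ℂ)) (μ := μ)] with w hw
    refine le_trans ?_ hx1
    rw [Lp.norm_def, ← toReal_enorm]
    refine ENNReal.toReal_mono (Lp.eLpNorm_ne_top _) ?_
    rw [eLpNorm_exponent_top]
    exact hw
  obtain ⟨a, ha, b, hb', c, hc', d, hd, h⟩ :=
    CRPProof.decomp B hK (Lp.stronglyMeasurable (J (A x))).measurable hb
  refine ⟨((a, b), (c, d)), ⟨⟨ha, hb'⟩, ⟨hc', hd⟩⟩, ?_⟩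
  have hi : Integrable (J (A x) : Ω → ℂ) μ := L1.integrable_coeFn _
  have : CRPProof.G B (J (A x) : Ω → ℂ) = B (J (A x)) := by
    simp only [CRPProof.G, hi, dif_pos]
    rw [Integrable.toL1_coeFn]
  simp only [ContinuousLinearMap.comp_apply]
  rw [← this, h]
end

section
/- Let μ be a probability measure, let E be a Banach space with the compact range property (CRP), and let S : L^∞(μ) → E be a 1-summing operator. Then S is compact. -/
open MeasureTheory ENNReal

/-- `T : X → Y` is `1`-summing if there is `C ≥ 0` such that for every finite family
`x₁, …, xₙ` in `X` one has
`∑ ‖T xᵢ‖ ≤ C · sup { ∑ |⟨xᵢ, x*⟩| : x* ∈ X*, ‖x*‖ ≤ 1 }`. -/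
def OneSumming {X Y : Type*} [NormedAddCommGroup X] [NormedSpace ℂ X]
    [NormedAddCommGroup Y] [NormedSpace ℂ Y] (T : X →L[ℂ] Y) : Prop :=
  ∃ C : ℝ, 0 ≤ C ∧ ∀ (n : ℕ) (x : Fin n → X),
    ∑ i, ‖T (x i)‖ ≤
      C * sSup {r : ℝ | ∃ φ : StrongDual ℂ X, ‖φ‖ ≤ 1 ∧ r = ∑ i, ‖φ (x i)‖}


namespace CRPaux

open Filter Topology

/-- The Cantor space. -/
abbrev KK := ℕ → Bool

/-- Continuous indicator of the cylinder determined by the first `n` coordinates `a`. -/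
noncomputable def atomFn (n : ℕ) (a : Fin n → Bool) : C(KK, ℂ) where
  toFun x := if (fun i : Fin n => x i) = a then 1 else 0
  continuous_toFun := by
    have h : Continuous (fun y : Fin n → Bool => if y = a then (1 : ℂ) else 0) :=
      continuous_of_discreteTopology
    have h2 : Continuous (fun (x : KK) (i : Fin n) => x i) := by fun_prop
    exact h.comp h2

/-- Continuous indicator of a coordinate half-space. -/
noncomputable def coordFn (n : ℕ) : C(KK, ℂ) where
  toFun x := if x n = true then 1 else 0
  continuous_toFun := by
    have h : Continuous (fun y : Bool => if y = true then (1 : ℂ) else 0) :=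
      continuous_of_discreteTopology
    exact h.comp (continuous_apply n)

/-- Extension of a finite word by `false`. -/
def extW (n : ℕ) (a : Fin n → Bool) : KK := fun i => if h : i < n then a ⟨i, h⟩ else false

/-- Truncation of `f` to the first `n` coordinates. -/
noncomputable def truncF (f : C(KK, ℂ)) (n : ℕ) : C(KK, ℂ) :=
  ∑ a : Fin n → Bool, f (extW n a) • atomFn n a

theorem truncF_apply (f : C(KK, ℂ)) (n : ℕ) (x : KK) :
    truncF f n x = f (extW n (fun i => x i)) := by
  simp [truncF, atomFn]

theorem tendsto_truncF (f : C(KK, ℂ)) : Tendsto (truncF f) atTop (𝓝 f) := by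
  rw [ContinuousMap.tendsto_iff_tendstoUniformly]
  have h1 : TendstoUniformly (fun (n : ℕ) (x : KK) => extW n (fun i => x i)) id atTop := by
    rw [tendstoUniformly_iff_tendsto, Pi.uniformity, tendsto_iInf]
    intro i
    rw [tendsto_comap_iff]
    refine Tendsto.mono_right ?_ refl_le_uniformity
    rw [tendsto_principal]
    have : ∀ᶠ n in (atTop : Filter ℕ), i < n := eventually_gt_atTop i
    filter_upwards [this.prod_inl (⊤ : Filter KK)] with p hp
    simp [extW, hp]
  have h2 := (CompactSpace.uniformContinuous_of_continuous f.continuous).comp_tendstoUniformly h1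
  simp_rw [truncF_apply]
  exact h2

theorem summing_bound {X E : Type*} [NormedAddCommGroup X] [NormedSpace ℂ X]
    [NormedAddCommGroup E] [NormedSpace ℂ E] (S : X →L[ℂ] E) (hS : OneSumming S)
    (L : C(KK, ℂ) →L[ℂ] X) :
    ∃ D : ℝ, 0 < D ∧ ∀ n, ∑ a : Fin n → Bool, ‖S (L (atomFn n a))‖ ≤ D := by
  obtain ⟨C, hC, h⟩ := hS
  refine ⟨C * ‖L‖ + 1, by positivity, fun n => ?_⟩
  have e := Fintype.equivFin (Fin n → Bool)
  have h1 := h _ (fun i => L (atomFn n (e.symm i)))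
  rw [e.symm.sum_comp (fun a => ‖S (L (atomFn n a))‖)] at h1
  refine h1.trans ?_
  have : sSup {r : ℝ | ∃ φ : StrongDual ℂ X, ‖φ‖ ≤ 1 ∧
      r = ∑ i, ‖φ (L (atomFn n (e.symm i)))‖} ≤ ‖L‖ := by
    refine Real.sSup_le ?_ (norm_nonneg _)
    rintro r ⟨φ, hφ, rfl⟩
    rw [e.symm.sum_comp (fun a => ‖φ (L (atomFn n a))‖)]
    choose c hc hc' using fun a => Complex.exists_norm_eq_mul_self (φ (L (atomFn n a)))
    have h2 : ((∑ a, ‖φ (L (atomFn n a))‖ : ℝ) : ℂ) = φ (L (∑ a, c a • atomFn n a)) := by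
      push_cast
      simp [hc']
    have h3 : ‖∑ a, c a • atomFn n a‖ ≤ 1 := by
      rw [ContinuousMap.norm_le _ zero_le_one]
      intro x
      simp [atomFn, hc]
    have h4 : ‖((∑ a, ‖φ (L (atomFn n a))‖ : ℝ) : ℂ)‖ ≤ ‖L‖ := by
      rw [h2]
      calc _ ≤ ‖φ‖ * (‖L‖ * ‖∑ a, c a • atomFn n a‖) :=
            (φ.le_opNorm _).trans (by gcongr; exact L.le_opNorm _)
        _ ≤ 1 * (‖L‖ * 1) := by gcongr
        _ = ‖L‖ := by ring
    rw [Complex.norm_real, Real.norm_of_nonneg (by positivity)] at h4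
    exact h4
  nlinarith

theorem exists_prob_n {E : Type*} [NormedAddCommGroup E] [NormedSpace ℂ E]
    (T : C(KK, ℂ) →L[ℂ] E) (D : ℝ) (hD : 0 < D) (n : ℕ)
    (h : ∑ a : Fin n → Bool, ‖T (atomFn n a)‖ ≤ D) :
    ∃ P : ProbabilityMeasure KK, ∀ f : C(KK, ℂ),
      ‖T (truncF f n)‖ ≤ D * ∫ x, ‖f x‖ ∂(P : Measure KK) := by
  set m := ∑ a : Fin n → Bool, ‖T (atomFn n a)‖ with hm
  have hm0 : 0 ≤ m := by positivity
  let M : Measure KK := ∑ a : Fin n → Bool,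
      ENNReal.ofReal (‖T (atomFn n a)‖ / D) • Measure.dirac (extW n a)
  let M' : Measure KK := ENNReal.ofReal ((D - m) / D) • Measure.dirac (fun _ => false)
  have hP : IsProbabilityMeasure (M + M') := by
    constructor
    simp only [M, M', Measure.add_apply, Measure.finsetSum_apply, Measure.smul_apply,
      measure_univ, smul_eq_mul, mul_one]
    rw [← ENNReal.ofReal_sum_of_nonneg (fun _ _ => by positivity), ← ENNReal.ofReal_add
      (by positivity) (div_nonneg (by linarith) hD.le), ← Finset.sum_div, ← hm]
    rw [← add_div]
    simp [hD.ne']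
  refine ⟨⟨M + M', hP⟩, fun f => ?_⟩
  have hi : ∀ (ν : Measure KK) [IsFiniteMeasure ν], Integrable (fun x => ‖f x‖) ν := fun ν _ =>
    Integrable.of_bound (by fun_prop) ‖f‖ (Eventually.of_forall fun x => by
      simpa using f.norm_coe_le_norm x)
  have hM : IsFiniteMeasure M := isFiniteMeasure_of_le (M + M') (Measure.le_add_right le_rfl)
  have hM' : IsFiniteMeasure M' := isFiniteMeasure_of_le (M + M') (Measure.le_add_left le_rfl)
  have e1 : ∫ x, ‖f x‖ ∂M = ∑ a : Fin n → Bool, ‖T (atomFn n a)‖ / D * ‖f (extW n a)‖ := by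
    rw [integral_finsetSum_measure]
    · refine Finset.sum_congr rfl fun a _ => ?_
      rw [integral_smul_measure, integral_dirac, ENNReal.toReal_ofReal (by positivity), smul_eq_mul]
    · intro a _
      exact (hi _).smul_measure ENNReal.ofReal_ne_top
  have e2 : ∫ x, ‖f x‖ ∂M ≤ ∫ x, ‖f x‖ ∂(M + M') := by
    rw [integral_add_measure (hi _) (hi _)]
    have : 0 ≤ ∫ x, ‖f x‖ ∂M' := integral_nonneg fun _ => norm_nonneg _
    linarith
  calc ‖T (truncF f n)‖ = ‖∑ a : Fin n → Bool, f (extW n a) • T (atomFn n a)‖ := by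
        simp [truncF]
    _ ≤ ∑ a : Fin n → Bool, ‖f (extW n a)‖ * ‖T (atomFn n a)‖ := by
        refine (norm_sum_le _ _).trans (le_of_eq ?_)
        simp [norm_smul]
    _ = D * ∫ x, ‖f x‖ ∂M := by
        rw [e1, Finset.mul_sum]
        refine Finset.sum_congr rfl fun a _ => ?_
        field_simp
    _ ≤ D * ∫ x, ‖f x‖ ∂(M + M') := by gcongr

theorem exists_dominating {E : Type*} [NormedAddCommGroup E] [NormedSpace ℂ E]
    (T : C(KK, ℂ) →L[ℂ] E) (D : ℝ) (hD : 0 < D)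
    (h : ∀ n, ∑ a : Fin n → Bool, ‖T (atomFn n a)‖ ≤ D) :
    ∃ P : ProbabilityMeasure KK, ∀ f : C(KK, ℂ),
      ‖T f‖ ≤ D * ∫ x, ‖f x‖ ∂(P : Measure KK) := by
  choose P hP using fun n => exists_prob_n T D hD n (h n)
  obtain ⟨Q, -, hQ⟩ := isCompact_univ.ultrafilter_le_nhds ((hyperfilter ℕ).map P) (by simp)
  have hQ' : Tendsto P (hyperfilter ℕ : Filter ℕ) (𝓝 Q) := hQ
  rw [ProbabilityMeasure.tendsto_iff_forall_integral_tendsto] at hQ'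
  refine ⟨Q, fun f => ?_⟩
  have t1 := hQ' (BoundedContinuousFunction.mkOfCompact ⟨fun x => ‖f x‖, by fun_prop⟩)
  have t2 : Tendsto (fun n => ‖T (truncF f n)‖) (hyperfilter ℕ : Filter ℕ) (𝓝 ‖T f‖) :=
    (((T.continuous.tendsto f).comp (tendsto_truncF f)).norm).mono_left Nat.hyperfilter_le_atTop
  exact le_of_tendsto_of_tendsto t2 (t1.const_mul D) (Eventually.of_forall fun n => hP n f)

theorem exists_totallyBounded {E : Type*} [NormedAddCommGroup E] [NormedSpace ℂ E]
    [CompleteSpace E] (hE : HasCRP E)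
    (T : C(KK, ℂ) →L[ℂ] E) (D : ℝ) (hD : 0 < D)
    (h : ∀ n, ∑ a : Fin n → Bool, ‖T (atomFn n a)‖ ≤ D) :
    ∃ R : Set E, IsCompact R ∧ ∀ n, T (coordFn n) ∈ R := by
  classical
  obtain ⟨P, hP⟩ := exists_dominating T D hD h
  set p : Measure KK := (P : Measure KK) with hp
  have hdense : DenseRange (ContinuousMap.toLp (E := ℂ) 1 p ℂ).toLinearMap :=
    ContinuousMap.toLp_denseRange ℂ p ℂ (by simp)
  have hnorm : ∀ f, ‖T.toLinearMap f‖ ≤ D * ‖(ContinuousMap.toLp (E := ℂ) 1 p ℂ).toLinearMap f‖ := by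
    intro f
    have : ‖(ContinuousMap.toLp (E := ℂ) 1 p ℂ) f‖ = ∫ x, ‖f x‖ ∂p := by
      rw [L1.norm_eq_integral_norm]
      refine integral_congr_ae ?_
      filter_upwards [ContinuousMap.coeFn_toLp (p := 1) (𝕜 := ℂ) p f] with x hx
      rw [hx]
    simpa [this] using hP f
  let U : Lp ℂ 1 p →L[ℂ] E :=
    T.toLinearMap.extendOfNorm (ContinuousMap.toLp (E := ℂ) 1 p ℂ).toLinearMap
  have hU : ∀ f, U (ContinuousMap.toLp (E := ℂ) 1 p ℂ f) = T f :=
    fun f => LinearMap.extendOfNorm_eq hdense ⟨D, hnorm⟩ f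
  have hUn : ∀ g, ‖U g‖ ≤ D * ‖g‖ := LinearMap.norm_extendOfNorm_apply_le hdense D hnorm
  let m : Set KK → E := fun s => if hs : MeasurableSet s then
    U (indicatorConstLp 1 hs (measure_ne_top p s) (1 : ℂ)) else 0
  have hm : ∀ s, ‖m s‖ ≤ D * p.real s := by
    intro s
    by_cases hs : MeasurableSet s
    · simp only [m, hs, dif_pos]
      refine (hUn _).trans (le_of_eq ?_)
      rw [norm_indicatorConstLp (by simp) (by simp)]
      simp
    · simp only [m, hs]
      simp only [dite_false, norm_zero]
      positivity
  have : IsFiniteMeasure (ENNReal.ofReal D • p) := Measure.smul_finite p ENNReal.ofReal_ne_top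
  let ν : VectorMeasure KK E := VectorMeasure.of_additive_of_le_measure
    (μ := ENNReal.ofReal D • p) m (by
      intro s
      rw [← ofReal_norm]
      refine (ENNReal.ofReal_le_ofReal (hm s)).trans (le_of_eq ?_)
      rw [ENNReal.ofReal_mul hD.le]
      simp) (by
      intro s t hs ht hst
      simp only [m, hs, ht, hs.union ht, dif_pos]
      rw [indicatorConstLp_disjoint_union hs ht _ _ hst, map_add]) (by
      intro s hs
      simp [m, hs])
  have hν : ∀ s, ν s = m s := fun s => rfl
  have hbv : BoundedVariationVM ν := by
    refine ⟨D, fun n s hs hd => ?_⟩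
    calc ∑ i, ‖ν (s i)‖ ≤ ∑ i, D * p.real (s i) := Finset.sum_le_sum fun i _ => hm (s i)
      _ = D * p.real (⋃ i, s i) := by
          rw [← Finset.mul_sum, measureReal_iUnion_fintype hd hs]
      _ ≤ D * 1 := by
          gcongr
          exact measureReal_le_one
      _ = D := mul_one D
  refine ⟨_, hE KK inferInstance ν hbv, fun n => subset_closure ⟨{x | x n = true}, ?_⟩⟩
  have hs : MeasurableSet {x : KK | x n = true} :=
    (measurable_pi_apply (X := fun _ : ℕ => Bool) n) (measurableSet_singleton true)
  rw [hν, ← hU]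
  simp only [m, hs, dif_pos]
  congr 1
  apply Lp.ext
  filter_upwards [ContinuousMap.coeFn_toLp (p := 1) (𝕜 := ℂ) p (coordFn n),
    indicatorConstLp_coeFn (p := 1) (hs := hs) (hμs := measure_ne_top p _) (c := (1 : ℂ))]
    with x h1 h2
  rw [h1, h2]
  simp [coordFn, Set.indicator]

theorem totallyBounded_of_seq {E : Type*} [NormedAddCommGroup E] (R : Set E)
    (h : ∀ u : ℕ → E, (∀ n, u n ∈ R) → ∃ K : Set E, IsCompact K ∧ ∀ n, u n ∈ K) :
    TotallyBounded R := by
  by_contra hR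
  rw [Metric.totallyBounded_iff] at hR
  push Not at hR
  obtain ⟨ε, hε, hR⟩ := hR
  have key : ∀ t : Finset E, ∃ y, y ∈ R ∧ ∀ x ∈ t, ε ≤ dist y x := by
    intro t
    obtain ⟨y, hy, hy'⟩ := Set.not_subset.1 (hR t t.finite_toSet)
    refine ⟨y, hy, fun x hx => ?_⟩
    by_contra hlt
    push Not at hlt
    exact hy' (Set.mem_biUnion (Finset.mem_coe.2 hx) hlt)
  obtain ⟨u, hu, hu'⟩ := exists_seq_of_forall_finset_exists (fun y => y ∈ R)
    (fun x y => ε ≤ dist y x) (fun t _ => key t)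
  obtain ⟨K, hK, hKu⟩ := h u hu
  obtain ⟨a, -, φ, hφ, hφ'⟩ := hK.isSeqCompact hKu
  obtain ⟨N, hN⟩ := Metric.cauchySeq_iff.1 hφ'.cauchySeq ε hε
  have h1 := hN (N + 1) (by omega) N le_rfl
  have h2 := hu' (φ N) (φ (N + 1)) (hφ (Nat.lt_succ_self N))
  exact absurd h1 (not_lt.2 h2)

section

variable {Ω : Type*} [MeasurableSpace Ω] (μ : Measure Ω) [IsProbabilityMeasure μ]

/-- The class in `L^∞` of an indicator. -/
noncomputable def indI {A : Set Ω} (hA : MeasurableSet A) : Lp ℂ ∞ μ :=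
  indicatorConstLp ∞ hA (measure_ne_top μ A) (1 : ℂ)

theorem indicators_totallyBounded
    {E : Type*} [NormedAddCommGroup E] [NormedSpace ℂ E] [CompleteSpace E]
    (hE : HasCRP E) (S : Lp ℂ ∞ μ →L[ℂ] E) (hS : OneSumming S) :
    TotallyBounded {y : E | ∃ (A : Set Ω) (hA : MeasurableSet A), y = S (indI μ hA)} := by
  classical
  refine totallyBounded_of_seq _ fun u hu => ?_
  choose A hA huA using hu
  let π : Ω → KK := fun ω n => decide (ω ∈ A n)
  have hπ : Measurable π := by
    refine measurable_pi_lambda _ fun n => ?_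
    refine measurable_to_bool ?_
    have : (fun ω => π ω n) ⁻¹' {true} = A n := by ext; simp [π]
    rw [this]
    exact hA n
  have hmp : MeasurePreserving π μ (μ.map π) := hπ.measurePreserving μ
  have : IsProbabilityMeasure (μ.map π) := Measure.isProbabilityMeasure_map hπ.aemeasurable
  let L : C(KK, ℂ) →L[ℂ] Lp ℂ ∞ μ :=
    (Lp.compMeasurePreservingₗᵢ ℂ π hmp).toContinuousLinearMap ∘L
      (ContinuousMap.toLp (E := ℂ) ∞ (μ.map π) ℂ)
  have hL : ∀ n, L (coordFn n) = indI μ (hA n) := by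
    intro n
    apply Lp.ext
    have h1 := Lp.coeFn_compMeasurePreserving
      (ContinuousMap.toLp (E := ℂ) ∞ (μ.map π) ℂ (coordFn n)) hmp
    have h2 := hmp.quasiMeasurePreserving.ae_eq_comp
      (ContinuousMap.coeFn_toLp (p := ∞) (𝕜 := ℂ) (μ.map π) (coordFn n))
    have h3 := indicatorConstLp_coeFn (p := ∞) (μ := μ) (hs := hA n)
      (hμs := measure_ne_top μ _) (c := (1 : ℂ))
    refine (h1.trans h2).trans (EventuallyEq.trans ?_ h3.symm)
    refine Eventually.of_forall fun ω => ?_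
    simp [coordFn, Set.indicator, π]
  obtain ⟨D, hD, hb⟩ := summing_bound S hS L
  obtain ⟨R, hR, hR'⟩ := exists_totallyBounded hE (S ∘L L) D hD hb
  refine ⟨R, hR, fun n => ?_⟩
  rw [huA, ← hL]
  exact hR' n

theorem memI {φ : Ω → ℝ} (hφ : Measurable φ) (h : ∀ ω, φ ω ∈ Set.Icc (0 : ℝ) 1) :
    MemLp (fun ω => (φ ω : ℂ)) ∞ μ :=
  MemLp.of_bound (by fun_prop) 1 (Eventually.of_forall fun ω => by
    simpa [abs_of_nonneg (h ω).1] using (h ω).2)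

theorem floor_approx (y : ℝ) (N : ℕ) (hN : 0 < N) (hy : y ∈ Set.Icc (0 : ℝ) 1) :
    |y - ∑ k ∈ Finset.range N, (N : ℝ)⁻¹ * (if ((k : ℝ) + 1) ≤ N * y then 1 else 0)| ≤ 1 / N := by
  have hN' : (0 : ℝ) < N := by exact_mod_cast hN
  have h0 : 0 ≤ N * y := mul_nonneg hN'.le hy.1
  have hle : ⌊N * y⌋₊ ≤ N := by
    have : N * y ≤ N := by nlinarith [hy.2]
    simpa using Nat.floor_le_floor this
  have hs : (Finset.range N).filter (fun k : ℕ => ((k : ℝ) + 1) ≤ N * y)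
      = Finset.range ⌊N * y⌋₊ := by
    ext k
    have : ((k : ℝ) + 1) ≤ N * y ↔ k + 1 ≤ ⌊N * y⌋₊ := by
      rw [Nat.le_floor_iff h0]; push_cast; rfl
    simp only [Finset.mem_filter, Finset.mem_range, this]
    omega
  rw [← Finset.mul_sum, Finset.sum_boole, hs, Finset.card_range]
  have f1 := Nat.floor_le h0
  have f2 := Nat.lt_floor_add_one (N * y)
  have : y - (N : ℝ)⁻¹ * ⌊N * y⌋₊ = (N * y - ⌊N * y⌋₊) / N := by field_simp
  rw [this, abs_div, abs_of_pos hN', abs_of_nonneg (by linarith)]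
  gcongr
  linarith

theorem mem_closedHull {E : Type*} [NormedAddCommGroup E] [NormedSpace ℂ E]
    (S : Lp ℂ ∞ μ →L[ℂ] E) {φ : Ω → ℝ} (hφ : Measurable φ) (h : ∀ ω, φ ω ∈ Set.Icc (0 : ℝ) 1) :
    S ((memI μ hφ h).toLp _) ∈ closure (convexHull ℝ
      {y : E | ∃ (A : Set Ω) (hA : MeasurableSet A), y = S (indI μ hA)}) := by
  set R := {y : E | ∃ (A : Set Ω) (hA : MeasurableSet A), y = S (indI μ hA)}
  have hA : ∀ N k : ℕ, MeasurableSet {ω | ((k : ℝ) + 1) ≤ N * φ ω} := fun N k =>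
    measurableSet_le measurable_const (by fun_prop)
  let F : ℕ → Lp ℂ ∞ μ := fun N => ∑ k ∈ Finset.range (N + 1),
    (((N + 1 : ℕ) : ℝ)⁻¹ : ℝ) • indI μ (hA (N + 1) k)
  have hF : ∀ N, S (F N) ∈ convexHull ℝ R := by
    intro N
    simp only [F, map_sum]
    have : ∀ k, S ((((N + 1 : ℕ) : ℝ)⁻¹ : ℝ) • indI μ (hA (N + 1) k))
        = (((N + 1 : ℕ) : ℝ)⁻¹ : ℝ) • S (indI μ (hA (N + 1) k)) := fun k =>
      (S.restrictScalars ℝ).map_smul _ _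
    simp only [this]
    refine (convex_convexHull ℝ R).sum_mem (fun _ _ => by positivity) ?_ fun k _ =>
      subset_convexHull ℝ R ⟨_, _, rfl⟩
    simp
    field_simp
  have hlim : Tendsto F atTop (𝓝 ((memI μ hφ h).toLp _)) := by
    rw [tendsto_iff_norm_sub_tendsto_zero]
    refine squeeze_zero (fun _ => norm_nonneg _) (fun N => ?_)
      (tendsto_one_div_add_atTop_nhds_zero_nat (𝕜 := ℝ))
    rw [norm_sub_rev]
    have hb := Lp.norm_le_of_ae_bound (μ := μ) (p := ∞)
      (f := (memI μ hφ h).toLp _ - F N) (C := 1 / ((N : ℝ) + 1)) (by positivity) ?_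
    · simpa using hb
    have i1 : ∀ᵐ ω ∂μ, ∀ k : ℕ, (indI μ (hA (N + 1) k)) ω =
        Set.indicator {ω | ((k : ℝ) + 1) ≤ (N + 1 : ℕ) * φ ω} (fun _ => (1 : ℂ)) ω :=
      ae_all_iff.2 fun k => indicatorConstLp_coeFn
    have i2 : ∀ᵐ ω ∂μ, ∀ k : ℕ, ((((N + 1 : ℕ) : ℝ)⁻¹ : ℝ) • indI μ (hA (N + 1) k) : Lp ℂ ∞ μ) ω =
        (((N + 1 : ℕ) : ℝ)⁻¹ : ℝ) • (indI μ (hA (N + 1) k)) ω :=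
      ae_all_iff.2 fun k => Lp.coeFn_smul _ _
    filter_upwards [i1, i2, (memI μ hφ h).coeFn_toLp, Lp.coeFn_sub ((memI μ hφ h).toLp _) (F N),
      Lp.coeFn_finsetSum (Finset.range (N + 1))
        (fun k => (((N + 1 : ℕ) : ℝ)⁻¹ : ℝ) • indI μ (hA (N + 1) k))] with ω w1 w2 w3 w4 w5
    rw [w4, Pi.sub_apply, w3]
    have e : (F N) ω = ((∑ k ∈ Finset.range (N + 1), ((N + 1 : ℕ) : ℝ)⁻¹ *
        (if ((k : ℝ) + 1) ≤ (N + 1 : ℕ) * φ ω then 1 else 0) : ℝ) : ℂ) := by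
      refine w5.trans ?_
      simp only [Finset.sum_apply, w2, w1]
      push_cast
      refine Finset.sum_congr rfl fun k _ => ?_
      by_cases hk : ((k : ℝ) + 1) ≤ (N + 1) * φ ω <;> simp [Set.indicator, hk]
    rw [e, ← Complex.ofReal_sub, Complex.norm_real, Real.norm_eq_abs]
    have := floor_approx (φ ω) (N + 1) (Nat.succ_pos N) (h ω)
    push_cast at this ⊢
    exact this
  exact mem_closure_of_tendsto ((S.continuous.tendsto _).comp hlim) (Eventually.of_forall hF)

/-- Clamp to `[0,1]`. -/
noncomputable def clampI (x : ℝ) : ℝ := max 0 (min x 1)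

theorem clampI_mem (x : ℝ) : clampI x ∈ Set.Icc (0 : ℝ) 1 := by
  unfold clampI
  exact ⟨le_max_left _ _, max_le zero_le_one (min_le_right _ _)⟩

theorem measurable_clampI : Measurable clampI := by
  unfold clampI
  fun_prop

theorem clampI_sub (x : ℝ) (h : |x| ≤ 1) : clampI x - clampI (-x) = x := by
  unfold clampI
  have := abs_le.1 h
  rw [min_eq_left this.2, min_eq_left (by linarith)]
  rcases le_total 0 x with h0 | h0
  · rw [max_eq_right h0, max_eq_left (by linarith)]; ring
  · rw [max_eq_left h0, max_eq_right (by linarith)]; ring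

end

end CRPaux

/-- If `μ` is a probability measure, `E` has the compact range property and
`S : L^∞(μ) → E` is `1`-summing, then `S` is compact. -/
theorem oneSumming_Linfty_isCompactOperator_of_hasCRP
    {Ω : Type*} [MeasurableSpace Ω] (μ : Measure Ω) [IsProbabilityMeasure μ]
    {E : Type*} [NormedAddCommGroup E] [NormedSpace ℂ E] [CompleteSpace E]
    (hE : HasCRP E) (S : Lp ℂ ∞ μ →L[ℂ] E) (hS : OneSumming S) :
    IsCompactOperator S := by
  have hTB := CRPaux.indicators_totallyBounded μ hE S hS
  set R := {y : E | ∃ (A : Set Ω) (hA : MeasurableSet A), y = S (CRPaux.indI μ hA)} with hR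
  have hQ : IsCompact (closure (convexHull ℝ R)) :=
    hTB.convexHull.closure.isCompact_of_isClosed isClosed_closure
  set Q := closure (convexHull ℝ R) with hQdef
  have hQ4 := ((hQ.prod hQ).prod (hQ.prod hQ)).image
    (f := fun z : (E × E) × (E × E) => (z.1.1 - z.1.2) + Complex.I • (z.2.1 - z.2.2))
    (by fun_prop)
  refine ⟨_, hQ4, Filter.mem_of_superset (Metric.closedBall_mem_nhds 0 zero_lt_one) ?_⟩
  intro f hf
  have hf1 : ‖f‖ ≤ 1 := by simpa using hf
  have hre : Measurable fun ω => (f ω).re :=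
    Complex.measurable_re.comp (Lp.stronglyMeasurable f).measurable
  have him : Measurable fun ω => (f ω).im :=
    Complex.measurable_im.comp (Lp.stronglyMeasurable f).measurable
  have key : ∀ g : Ω → ℝ, ∀ hg : Measurable g,
      S ((CRPaux.memI μ (CRPaux.measurable_clampI.comp hg)
        (fun ω => CRPaux.clampI_mem (g ω))).toLp _) ∈ Q :=
    fun g hg => CRPaux.mem_closedHull μ S (CRPaux.measurable_clampI.comp hg)
      (fun ω => CRPaux.clampI_mem (g ω))
  refine ⟨((_, _), (_, _)), ⟨⟨key _ hre, key _ hre.neg⟩, ⟨key _ him, key _ him.neg⟩⟩, ?_⟩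
  simp only [← map_sub, ← map_smul, ← map_add]
  congr 1
  apply Lp.ext
  have hb : ∀ᵐ ω ∂μ, ‖f ω‖ ≤ 1 := by
    filter_upwards [ae_le_eLpNormEssSup (f := f) (μ := μ)] with ω hω
    rw [← eLpNorm_exponent_top, ← Lp.enorm_def] at hω
    have := hω.trans (enorm_le_iff_norm_le.2 (by simpa using hf1) : ‖f‖ₑ ≤ ‖(1 : ℝ)‖ₑ)
    simpa using enorm_le_iff_norm_le.1 this
  rw [← MemLp.toLp_sub, ← MemLp.toLp_sub, ← MemLp.toLp_const_smul, ← MemLp.toLp_add]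
  refine (MemLp.coeFn_toLp _).trans ?_
  filter_upwards [hb] with ω hω
  have r1 := CRPaux.clampI_sub _ ((Complex.abs_re_le_norm (f ω)).trans hω)
  have r2 := CRPaux.clampI_sub _ ((Complex.abs_im_le_norm (f ω)).trans hω)
  simp only [Pi.add_apply, Pi.sub_apply, Pi.smul_apply, Function.comp_apply, Pi.neg_apply,
    smul_eq_mul]
  rw [← Complex.ofReal_sub, ← Complex.ofReal_sub, r1, r2, mul_comm]
  exact Complex.re_add_im (f ω)
end

section
/- Let 𝒜 be a C*-algebra, let E be a Banach space with the compact range property (CRP), and let T : 𝒜 → E be a 1-summing operator. Then T is compact. -/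
open MeasureTheory ENNReal

open Filter Topology

section crpaux

/-- The compact range property, transported to arbitrary universes. -/
lemma crp_totallyBounded_range {E : Type*} [NormedAddCommGroup E]
    (hE : HasCRP E) {Ω : Type*} [MeasurableSpace Ω] (ν : VectorMeasure Ω E)
    (hν : BoundedVariationVM ν) : TotallyBounded (Set.range ν) := by
  by_contra hcon
  rw [Metric.totallyBounded_iff] at hcon
  push Not at hcon
  obtain ⟨ε, hε, h⟩ := hcon
  have hex : ∀ s : Finset (Set Ω), (∀ x ∈ s, MeasurableSet x) →
      ∃ y, MeasurableSet y ∧ ∀ x ∈ s, ε ≤ dist (ν x) (ν y) := by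
    intro s _
    have h1 := h ((fun x => ν x) '' (s : Set (Set Ω))) (s.finite_toSet.image _)
    rw [Set.not_subset] at h1
    obtain ⟨_, ⟨y, rfl⟩, hy⟩ := h1
    simp only [Set.mem_image, Set.mem_iUnion, Metric.mem_ball, not_exists, not_lt] at hy
    have hy' : ∀ x ∈ s, ε ≤ dist (ν x) (ν y) := fun x hx => by
      rw [dist_comm]; exact hy (ν x) ⟨x, hx, rfl⟩
    by_cases hm : MeasurableSet y
    · exact ⟨y, hm, hy'⟩
    · refine ⟨∅, MeasurableSet.empty, fun x hx => ?_⟩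
      have := hy' x hx
      rwa [ν.not_measurable hm, ← ν.empty] at this
  obtain ⟨B, hB, hsep⟩ := exists_seq_of_forall_finset_exists MeasurableSet
    (fun x y => ε ≤ dist (ν x) (ν y)) hex
  classical
  let π : Ω → (ℕ → Bool) := fun ω n => decide (ω ∈ B n)
  have hπ : Measurable π := by
    refine measurable_pi_lambda _ fun n => ?_
    refine measurable_to_bool ?_
    have : (fun c => π c n) ⁻¹' {true} = B n := by ext ω; simp [π]
    rw [this]; exact hB n
  obtain ⟨C, hC⟩ := hν
  have hbv : BoundedVariationVM (ν.map π) := by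
    refine ⟨C, fun n s hs hd => ?_⟩
    have := hC n (fun i => π ⁻¹' (s i)) (fun i => hπ (hs i))
      (fun i j hij => Disjoint.preimage _ (hd hij))
    simpa only [VectorMeasure.map_apply ν hπ (hs _)] using this
  have hK := hE _ _ (ν.map π) hbv
  have hmem : ∀ n, ν (B n) ∈ closure (Set.range (ν.map π)) := by
    intro n
    apply subset_closure
    refine ⟨{s | s n = true}, ?_⟩
    have hm : MeasurableSet {s : ℕ → Bool | s n = true} :=
      measurableSet_eq_fun (measurable_pi_apply n) measurable_const
    rw [VectorMeasure.map_apply ν hπ hm]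
    congr 1
    ext ω; simp [π]
  obtain ⟨a, -, φ, hφ, hlim⟩ := hK.tendsto_subseq hmem
  have hc := hlim.cauchySeq
  rw [Metric.cauchySeq_iff'] at hc
  obtain ⟨N, hN⟩ := hc ε hε
  have h1 := hN (N+1) (Nat.le_succ N)
  have h2 := hsep (φ N) (φ (N+1)) (hφ (Nat.lt_succ_self N))
  rw [dist_comm] at h1
  exact absurd h1 (not_lt.mpr h2)

/-- A bounded operator is compact as soon as the functionals which are small on a fixed totally
bounded set are uniformly small on the image of the ball. -/
lemma totallyBounded_of_dual_small {E H : Type*} [NormedAddCommGroup E] [NormedSpace ℝ E]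
    [NormedAddCommGroup H] [NormedSpace ℝ H] (T : H →L[ℝ] E) (S : Set E) (hS : TotallyBounded S)
    (C : ℝ) (hC : 0 ≤ C)
    (h : ∀ (y : StrongDual ℝ E) (δ : ℝ), ‖y‖ ≤ 1 → 0 ≤ δ → (∀ z ∈ S, |y z| ≤ δ) →
      ∀ κ : H, ‖κ‖ ≤ 1 → (y (T κ)) ^ 2 ≤ C * δ) :
    TotallyBounded (T '' Metric.closedBall 0 1) := by
  rw [Metric.totallyBounded_iff]
  intro ε hε
  let δ : ℝ := (ε / 2) ^ 2 / (2 * (C + 1))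
  have hδ : 0 < δ := by positivity
  have hCδ : C * δ < (ε / 2) ^ 2 := by
    have : C * δ = (ε / 2) ^ 2 * (C / (2 * (C + 1))) := by simp only [δ]; ring
    rw [this]
    have h2 : C / (2 * (C + 1)) < 1 := by
      rw [div_lt_one (by positivity)]; linarith
    have : 0 < (ε / 2) ^ 2 := by positivity
    nlinarith
  obtain ⟨F, hF, hcov⟩ := Metric.totallyBounded_iff.1 hS δ hδ
  let V : Submodule ℝ E := Submodule.span ℝ F
  have : FiniteDimensional ℝ V := FiniteDimensional.span_of_finite ℝ hF
  have : IsClosed (V : Set E) := V.closed_of_finiteDimensional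
  have key : ∀ κ : H, ‖κ‖ ≤ 1 → ∃ v : V, ‖T κ - v‖ < ε / 2 := by
    intro κ hκ
    obtain ⟨g, hg, hgx⟩ := exists_dual_vector'' ℝ (V.mkQL (T κ))
    let y : StrongDual ℝ E := g.comp V.mkQL
    have hyle : ∀ z, |y z| ≤ ‖z‖ := by
      intro z
      have h1 : ‖g (V.mkQL z)‖ ≤ ‖g‖ * ‖V.mkQL z‖ := g.le_opNorm _
      have h2 : ‖V.mkQL z‖ ≤ ‖z‖ := Submodule.Quotient.norm_mk_le V z
      have h3 : ‖g‖ * ‖V.mkQL z‖ ≤ 1 * ‖V.mkQL z‖ := by gcongr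
      change ‖g (V.mkQL z)‖ ≤ _
      linarith
    have hy : ‖y‖ ≤ 1 := ContinuousLinearMap.opNorm_le_bound _ zero_le_one
      (fun z => by rw [one_mul]; exact hyle z)
    have hyS : ∀ z ∈ S, |y z| ≤ δ := by
      intro z hz
      have := hcov hz
      simp only [Set.mem_iUnion, Metric.mem_ball, exists_prop] at this
      obtain ⟨w, hw, hzw⟩ := this
      have hw0 : y w = 0 := by
        change g (V.mkQL w) = 0
        have : V.mkQL w = 0 := (Submodule.Quotient.mk_eq_zero V).2 (Submodule.subset_span hw)
        rw [this, map_zero]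
      have : y z = y (z - w) := by rw [map_sub, hw0, sub_zero]
      rw [this]
      refine (hyle _).trans ?_
      rw [← dist_eq_norm]; exact hzw.le
    have hfin := h y δ hy hδ.le hyS κ hκ
    have hyT : y (T κ) = ‖V.mkQL (T κ)‖ := hgx
    rw [hyT] at hfin
    have hlt : ‖V.mkQL (T κ)‖ < ε / 2 :=
      lt_of_pow_lt_pow_left₀ 2 (by positivity) (hfin.trans_lt hCδ)
    obtain ⟨m, hm, hmlt⟩ := (QuotientAddGroup.norm_lt_iff (S := V.toAddSubgroup)
      (x := (QuotientAddGroup.mk (T κ)))).1 hlt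
    have hmem : T κ - m ∈ V := by
      have := QuotientAddGroup.eq.1 hm
      rw [neg_add_eq_sub] at this
      exact this
    exact ⟨⟨_, hmem⟩, by simpa using hmlt⟩
  have hball : TotallyBounded ((fun v : V => (v : E)) '' Metric.closedBall (0 : V) (‖T‖ + ε)) :=
    (isCompact_closedBall (0 : V) (‖T‖ + ε)).totallyBounded.image
      uniformContinuous_subtype_val
  obtain ⟨G, hG, hGcov⟩ := Metric.totallyBounded_iff.1 hball (ε / 2) (by positivity)
  refine ⟨G, hG, ?_⟩
  rintro _ ⟨κ, hκ, rfl⟩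
  have hκ' : ‖κ‖ ≤ 1 := by simpa using hκ
  obtain ⟨v, hv⟩ := key κ hκ'
  have hvn : ‖v‖ ≤ ‖T‖ + ε := by
    have h1 : ‖(v : E)‖ ≤ ‖T κ‖ + ‖T κ - v‖ := by
      have := norm_sub_le (T κ) (T κ - v)
      simpa using this
    have h2 : ‖T κ‖ ≤ ‖T‖ := T.unit_le_opNorm κ hκ'
    have h3 : ‖v‖ = ‖(v : E)‖ := rfl
    linarith
  have hvm := hGcov ⟨v, by simpa using hvn, rfl⟩
  simp only [Set.mem_iUnion, Metric.mem_ball, exists_prop] at hvm ⊢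
  obtain ⟨w, hw, hd⟩ := hvm
  refine ⟨w, hw, ?_⟩
  have h4 : dist (T κ) w ≤ dist (T κ) v + dist (v : E) w := dist_triangle _ _ _
  rw [dist_eq_norm (T κ) (v : E)] at h4
  linarith

end crpaux

section coreaux

variable {Ω : Type*} [MeasurableSpace Ω] (μ : Measure Ω) [IsFiniteMeasure μ]

/-- Indicator function of `B` as an element of `L²`. -/
noncomputable def indL2 (B : Set Ω) (hB : MeasurableSet B) : Lp ℝ 2 μ :=
  indicatorConstLp 2 hB (measure_ne_top μ B) (1 : ℝ)

lemma indL2_finset_sum (f : ℕ → Set Ω) (hf : ∀ i, MeasurableSet (f i))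
    (hd : Pairwise (Function.onFun Disjoint f)) (s : Finset ℕ) :
    ∑ i ∈ s, indL2 μ (f i) (hf i) =
      indL2 μ (⋃ i ∈ s, f i) (s.measurableSet_biUnion fun i _ => hf i) := by
  classical
  induction s using Finset.induction_on with
  | empty => simp [indL2]
  | insert a s ha ih =>
    rw [Finset.sum_insert ha, ih]
    have hdis : Disjoint (f a) (⋃ i ∈ s, f i) := by
      rw [Set.disjoint_iUnion₂_right]
      intro i hi
      exact hd (fun h => ha (h ▸ hi))
    simp only [indL2]
    rw [← indicatorConstLp_disjoint_union (hf a) (s.measurableSet_biUnion fun i _ => hf i)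
      (measure_ne_top μ _) (measure_ne_top μ _) hdis]
    congr 1
    simp

lemma indL2_hasSum (f : ℕ → Set Ω) (hf : ∀ i, MeasurableSet (f i))
    (hd : Pairwise (Function.onFun Disjoint f)) :
    HasSum (fun i => indL2 μ (f i) (hf i)) (indL2 μ (⋃ i, f i) (MeasurableSet.iUnion hf)) := by
  change Tendsto (fun s : Finset ℕ => ∑ i ∈ s, indL2 μ (f i) (hf i)) atTop _
  simp_rw [indL2_finset_sum μ f hf hd]
  refine tendsto_indicatorConstLp_set (by norm_num) ?_
  have h1 : Tendsto (fun s : Finset ℕ => μ (⋃ i ∈ s, f i)) atTop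
      (𝓝 (μ (⋃ s : Finset ℕ, ⋃ i ∈ s, f i))) := by
    refine tendsto_measure_iUnion_atTop ?_
    intro s t hst
    exact Set.biUnion_subset_biUnion_left hst
  rw [← Set.iUnion_eq_iUnion_finset] at h1
  have h2 : ∀ s : Finset ℕ, μ (symmDiff (⋃ i ∈ s, f i) (⋃ i, f i)) =
      μ (⋃ i, f i) - μ (⋃ i ∈ s, f i) := by
    intro s
    have hsub : (⋃ i ∈ s, f i) ⊆ ⋃ i, f i := Set.iUnion₂_subset_iUnion _ _
    rw [Set.symmDiff_def, Set.sdiff_eq_empty.2 hsub, Set.empty_union,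
      measure_sdiff hsub (s.measurableSet_biUnion fun i _ => hf i).nullMeasurableSet
        (measure_ne_top μ _)]
  simp_rw [h2]
  have h3 := ENNReal.Tendsto.sub (tendsto_const_nhds (x := μ (⋃ i, f i)) (f := atTop)) h1
    (Or.inl (measure_ne_top μ _))
  simpa using h3

open Classical in
/-- The vector measure `B ↦ W 1_B`. -/
noncomputable def vmOf {E : Type*} [NormedAddCommGroup E] [NormedSpace ℝ E]
    (W : Lp ℝ 2 μ →L[ℝ] E) : VectorMeasure Ω E where
  measureOf' B := if hB : MeasurableSet B then W (indL2 μ B hB) else 0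
  empty' := by simp [indL2]
  not_measurable' := by intro i hi; simp [hi]
  m_iUnion' := by
    intro f hf hd
    have := (indL2_hasSum μ f hf hd).mapL W
    simpa [hf, MeasurableSet.iUnion hf] using this

lemma vmOf_apply {E : Type*} [NormedAddCommGroup E] [NormedSpace ℝ E]
    (W : Lp ℝ 2 μ →L[ℝ] E) {B : Set Ω} (hB : MeasurableSet B) :
    vmOf μ W B = W (indL2 μ B hB) := dif_pos hB

open InnerProductSpace in
/-- Core of the argument: an operator on a Hilbert space dominated by an `L¹`-norm, under a
positivity assumption, is compact if the target has the CRP. -/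
lemma core_compact {E : Type*} [NormedAddCommGroup E] [NormedSpace ℝ E] (hE : HasCRP E)
    {H : Type*} [NormedAddCommGroup H] [InnerProductSpace ℝ H] [CompleteSpace H]
    (J : H →L[ℝ] Lp ℝ 2 μ) (T : H →L[ℝ] E) (C : ℝ) (hC : 0 ≤ C)
    (hT : ∀ κ, ‖T κ‖ ≤ C * ∫ ω, |J κ ω| ∂μ)
    (hpos : ∀ (B : Set Ω) (hB : MeasurableSet B),
      0 ≤ᵐ[μ] J (ContinuousLinearMap.adjoint J (indL2 μ B hB))) :
    TotallyBounded (T '' Metric.closedBall 0 1) := by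
  have hInt : ∀ g : Lp ℝ 2 μ, Integrable g μ := fun g =>
    (Lp.memLp g).integrable (by norm_num)
  have hinner : ∀ (B : Set Ω) (hB : MeasurableSet B) (g : Lp ℝ 2 μ),
      ⟪indL2 μ B hB, g⟫_ℝ = ∫ ω in B, g ω ∂μ := fun B hB g =>
    L2.inner_indicatorConstLp_one hB (measure_ne_top μ B) g
  set W : Lp ℝ 2 μ →L[ℝ] E := T.comp (ContinuousLinearMap.adjoint J) with hW
  set u : Lp ℝ 2 μ := indL2 μ Set.univ MeasurableSet.univ with hu
  have hbv : BoundedVariationVM (vmOf μ W) := by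
    let w : Lp ℝ 2 μ := J (ContinuousLinearMap.adjoint J u)
    refine ⟨C * ∫ ω, |w ω| ∂μ, fun n s hs hd => ?_⟩
    have hone : ∀ i, ‖vmOf μ W (s i)‖ ≤ C * ∫ ω in s i, |w ω| ∂μ := by
      intro i
      rw [vmOf_apply μ W (hs i)]
      refine (hT (ContinuousLinearMap.adjoint J (indL2 μ (s i) (hs i)))).trans ?_
      refine mul_le_mul_of_nonneg_left ?_ hC
      have h1 : ∫ ω, |J (ContinuousLinearMap.adjoint J (indL2 μ (s i) (hs i))) ω| ∂μ =
          ∫ ω, J (ContinuousLinearMap.adjoint J (indL2 μ (s i) (hs i))) ω ∂μ := by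
        refine integral_congr_ae ?_
        filter_upwards [hpos (s i) (hs i)] with ω hω
        exact abs_of_nonneg hω
      rw [h1, ← setIntegral_univ, ← hinner Set.univ MeasurableSet.univ,
        ← ContinuousLinearMap.adjoint_inner_left, real_inner_comm,
        ContinuousLinearMap.adjoint_inner_left, hinner]
      exact integral_mono (hInt _).integrableOn (hInt _).abs.integrableOn (fun ω => le_abs_self _)
    calc ∑ i, ‖vmOf μ W (s i)‖ ≤ ∑ i, C * ∫ ω in s i, |w ω| ∂μ :=
          Finset.sum_le_sum fun i _ => hone i
      _ = C * ∑ i, ∫ ω in s i, |w ω| ∂μ := by rw [Finset.mul_sum]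
      _ = C * ∫ ω in ⋃ i, s i, |w ω| ∂μ := by
          rw [integral_iUnion_fintype hs hd fun i => (hInt _).abs.integrableOn]
      _ ≤ C * ∫ ω, |w ω| ∂μ := by
          refine mul_le_mul_of_nonneg_left ?_ hC
          exact setIntegral_le_integral (hInt _).abs (ae_of_all _ fun ω => abs_nonneg _)
  have htb := crp_totallyBounded_range hE _ hbv
  refine totallyBounded_of_dual_small T _ htb (2 * C) (by positivity) ?_
  intro y δ hy hδ hsmall κ hκ
  let v : H := (InnerProductSpace.toDual ℝ H).symm (y.comp T)
  have hv : ∀ x : H, ⟪v, x⟫_ℝ = y (T x) := fun x => by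
    simp [v, InnerProductSpace.toDual_symm_apply]
  have hl1 : ∫ ω, |J v ω| ∂μ ≤ 2 * δ := by
    have hset : ∀ (B : Set Ω), MeasurableSet B → |∫ ω in B, J v ω ∂μ| ≤ δ := by
      intro B hB
      rw [← hinner B hB, ← ContinuousLinearMap.adjoint_inner_left, real_inner_comm, hv]
      have := hsmall (vmOf μ W B) ⟨B, rfl⟩
      rwa [vmOf_apply μ W hB] at this
    have hsm := Lp.stronglyMeasurable (J v)
    have hP : MeasurableSet {ω | 0 ≤ J v ω} := measurableSet_le measurable_const hsm.measurable
    have e1 := integral_add_compl hP (hInt (J v)).abs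
    have e2 : ∫ ω in {ω | 0 ≤ J v ω}, |J v ω| ∂μ = ∫ ω in {ω | 0 ≤ J v ω}, J v ω ∂μ :=
      setIntegral_congr_fun hP fun ω hω => abs_of_nonneg hω
    have e3 : ∫ ω in {ω | 0 ≤ J v ω}ᶜ, |J v ω| ∂μ = - ∫ ω in {ω | 0 ≤ J v ω}ᶜ, J v ω ∂μ := by
      rw [← integral_neg]
      exact setIntegral_congr_fun hP.compl fun ω hω => abs_of_neg (not_le.1 hω)
    have b1 := hset _ hP
    have b2 := hset _ hP.compl
    rw [← e1, e2, e3]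
    have b3 := (abs_le.1 b1).2
    have b4 := (abs_le.1 b2).1
    linarith
  have hvsq : ‖v‖ ^ 2 ≤ 2 * C * δ := by
    have h1 : ‖v‖ ^ 2 = y (T v) := by rw [← hv, real_inner_self_eq_norm_sq]
    have h2 : y (T v) ≤ ‖y‖ * ‖T v‖ := (le_abs_self _).trans (y.le_opNorm _)
    have h3 : ‖y‖ * ‖T v‖ ≤ 1 * ‖T v‖ := by gcongr
    have h4 : C * ∫ ω, |J v ω| ∂μ ≤ C * (2 * δ) := by gcongr
    have h5 := hT v
    nlinarith
  have h6 : |y (T κ)| ≤ ‖v‖ := by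
    rw [← hv]
    refine (abs_real_inner_le_norm _ _).trans ?_
    nlinarith [norm_nonneg v]
  calc (y (T κ)) ^ 2 = |y (T κ)| ^ 2 := (sq_abs _).symm
    _ ≤ ‖v‖ ^ 2 := by gcongr
    _ ≤ _ := hvsq

end coreaux

section hilbertaux

universe u

open InnerProductSpace in
/-- Completion of a positive semidefinite symmetric bilinear form. -/
lemma exists_hilbert_of_form {X : Type u} [AddCommGroup X] [Module ℝ X]
    (B : X →ₗ[ℝ] X →ₗ[ℝ] ℝ) (hsymm : ∀ x y, B x y = B y x) (hpos : ∀ x, 0 ≤ B x x) :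
    ∃ (H : Type u) (_ : NormedAddCommGroup H) (_ : InnerProductSpace ℝ H) (_ : CompleteSpace H)
      (j : X →ₗ[ℝ] H), DenseRange j ∧ ∀ x y, ⟪j x, j y⟫_ℝ = B x y := by
  let core : PreInnerProductSpace.Core ℝ X :=
    { inner := fun x y => B x y
      conj_inner_symm := fun x y => by simpa using hsymm y x
      re_inner_nonneg := fun x => by simpa using hpos x
      add_left := fun x y z => by simp
      smul_left := fun x y r => by simp }
  let _ : SeminormedAddCommGroup X :=
    InnerProductSpace.Core.toSeminormedAddCommGroup (c := core)
  let _ : InnerProductSpace ℝ X := InnerProductSpace.ofCore core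
  refine ⟨UniformSpace.Completion X, inferInstance, inferInstance, inferInstance,
    (UniformSpace.Completion.toComplL (𝕜 := ℝ) (E := X)).toLinearMap, ?_, ?_⟩
  · exact UniformSpace.Completion.denseRange_coe
  · intro x y
    exact UniformSpace.Completion.inner_coe x y

open InnerProductSpace in
lemma integral_abs_eq_inner {Ω : Type*} [MeasurableSpace Ω] (μ : Measure Ω) [IsFiniteMeasure μ]
    (g : Lp ℝ 2 μ) :
    ∫ ω, |g ω| ∂μ = ⟪indL2 μ Set.univ MeasurableSet.univ, |g|⟫_ℝ := by
  rw [indL2, L2.inner_indicatorConstLp_one, setIntegral_univ]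
  refine integral_congr_ae ?_
  filter_upwards [Lp.coeFn_abs g] with ω hω
  exact hω.symm

open InnerProductSpace in
lemma abstract_compact {E : Type*} [NormedAddCommGroup E] [NormedSpace ℝ E] [CompleteSpace E]
    (hE : HasCRP E)
    {X : Type*} [AddCommGroup X] [Module ℝ X]
    {Ω : Type*} [TopologicalSpace Ω] [CompactSpace Ω] [MeasurableSpace Ω] [BorelSpace Ω]
    (μ : Measure Ω) [IsFiniteMeasure μ] (ev : X →ₗ[ℝ] C(Ω, ℝ))
    (B : X →ₗ[ℝ] X →ₗ[ℝ] ℝ) (hsymm : ∀ x y, B x y = B y x)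
    (hB : ∀ x, ∫ ω, (ev x ω) ^ 2 ∂μ ≤ B x x)
    (hdec : ∀ x, ∃ p q : X, x = p - q ∧ B p q = 0 ∧ (∀ ω, 0 ≤ ev p ω) ∧ (∀ ω, 0 ≤ ev q ω))
    (T : X →ₗ[ℝ] E) (C : ℝ) (hC : 0 ≤ C) (hT : ∀ x, ‖T x‖ ≤ C * ∫ ω, |ev x ω| ∂μ) :
    TotallyBounded (T '' {x | B x x ≤ 1}) := by
  obtain ⟨H, i1, i2, i3, j, hj, hjB⟩ := exists_hilbert_of_form B hsymm
    (fun x => (integral_nonneg fun ω => sq_nonneg _).trans (hB x))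
  let J0 : X →ₗ[ℝ] Lp ℝ 2 μ := (ContinuousMap.toLp (E := ℝ) 2 μ ℝ).toLinearMap ∘ₗ ev
  have hJ0c : ∀ x, J0 x =ᵐ[μ] ev x := fun x => ContinuousMap.coeFn_toLp (𝕜 := ℝ) μ (ev x)
  have hJ0 : ∀ x, ‖J0 x‖ ≤ 1 * ‖j x‖ := by
    intro x
    rw [one_mul]
    refine le_of_sq_le_sq ?_ (norm_nonneg _)
    rw [← real_inner_self_eq_norm_sq, ← real_inner_self_eq_norm_sq, hjB, L2.inner_def]
    refine le_trans (le_of_eq ?_) (hB x)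
    refine integral_congr_ae ?_
    filter_upwards [hJ0c x] with ω hω
    simp [hω, sq]
  let u : Lp ℝ 2 μ := indL2 μ Set.univ MeasurableSet.univ
  have hJabs : ∀ x, ∫ ω, |ev x ω| ∂μ = ⟪u, |J0 x|⟫_ℝ := by
    intro x
    rw [← integral_abs_eq_inner]
    refine integral_congr_ae ?_
    filter_upwards [hJ0c x] with ω hω
    simp [hω]
  have hT' : ∀ x, ‖T x‖ ≤ (C * ‖u‖) * ‖j x‖ := by
    intro x
    refine (hT x).trans ?_
    rw [hJabs, mul_assoc]
    refine mul_le_mul_of_nonneg_left ?_ hC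
    refine (real_inner_le_norm _ _).trans ?_
    rw [norm_abs_eq_norm]
    have := hJ0 x
    rw [one_mul] at this
    gcongr
  let J : H →L[ℝ] Lp ℝ 2 μ := J0.extendOfNorm j
  have hJ : ∀ x, J (j x) = J0 x := fun x => LinearMap.extendOfNorm_eq hj ⟨_, hJ0⟩ x
  let S : H →L[ℝ] E := T.extendOfNorm j
  have hS : ∀ x, S (j x) = T x := fun x => LinearMap.extendOfNorm_eq hj ⟨_, hT'⟩ x
  have key : TotallyBounded (S '' Metric.closedBall 0 1) := by
    refine core_compact μ hE J S C hC ?_ ?_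
    · intro κ
      rw [integral_abs_eq_inner]
      refine hj.induction_on (p := fun κ => ‖S κ‖ ≤ C * ⟪u, |J κ|⟫_ℝ) κ ?_ ?_
      · refine isClosed_le (by fun_prop) ?_
        exact continuous_const.mul (continuous_const.inner (J.continuous.sup J.continuous.neg))
      · intro x
        rw [hS, hJ, ← hJabs]
        exact hT x
    · intro D hD
      set κ : H := ContinuousLinearMap.adjoint J (indL2 μ D hD) with hκ
      have hκin : ∀ x, (∀ ω, 0 ≤ ev x ω) → 0 ≤ ⟪κ, j x⟫_ℝ := by
        intro x hx
        rw [hκ, ContinuousLinearMap.adjoint_inner_left, hJ, indL2,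
          L2.inner_indicatorConstLp_one]
        refine integral_nonneg_of_ae ?_
        filter_upwards [ae_restrict_of_ae (hJ0c x)] with ω hω
        rw [hω]; exact hx ω
      have hcl : κ ∈ closure (j '' {x | ∀ ω, 0 ≤ ev x ω}) := by
        rw [Metric.mem_closure_iff]
        intro ε hε
        obtain ⟨x, hx⟩ := Metric.denseRange_iff.1 hj κ ε hε
        obtain ⟨p, q, rfl, hpq, hp, hq⟩ := hdec x
        refine ⟨j p, ⟨p, hp, rfl⟩, lt_of_le_of_lt ?_ hx⟩
        rw [dist_eq_norm, dist_eq_norm]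
        refine le_of_sq_le_sq ?_ (norm_nonneg _)
        have e : κ - j (p - q) = (κ - j p) + j q := by rw [map_sub]; abel
        rw [e, norm_add_sq_real, inner_sub_left, hjB, hpq]
        have := hκin q hq
        nlinarith [sq_nonneg ‖j q‖]
      have hJκ : 0 ≤ J κ := by
        have hclosed : IsClosed {v : H | 0 ≤ J v} := isClosed_le continuous_const J.continuous
        refine closure_minimal ?_ hclosed hcl
        rintro _ ⟨x, hx, rfl⟩
        change 0 ≤ J (j x)
        rw [hJ, ← Lp.coeFn_nonneg]
        filter_upwards [hJ0c x] with ω hω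
        rw [hω]; exact hx ω
      exact (Lp.coeFn_nonneg _).2 hJκ
  refine key.subset ?_
  rintro _ ⟨x, hx, rfl⟩
  refine ⟨j x, ?_, hS x⟩
  rw [mem_closedBall_zero_iff]
  refine le_of_sq_le_sq ?_ zero_le_one
  rw [← real_inner_self_eq_norm_sq, hjB, one_pow]
  exact hx

end hilbertaux

section pietschaux

/-- Pietsch domination. -/
lemma pietsch_domination {X : Type*} [AddCommGroup X] [Module ℝ X]
    {Ω : Type*} [TopologicalSpace Ω] [CompactSpace Ω] [T2Space Ω] [MeasurableSpace Ω]
    [BorelSpace Ω] (ev : X →ₗ[ℝ] C(Ω, ℝ)) (p : X → ℝ)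
    (hp : ∀ (c : ℝ) (x : X), 0 ≤ c → p (c • x) = c * p x) (C : ℝ) (hC : 0 ≤ C)
    (h : ∀ (n : ℕ) (x : Fin n → X), ∃ ω, ∑ i, p (x i) ≤ C * ∑ i, |ev (x i) ω|) :
    ∃ (μ : Measure Ω) (_ : IsFiniteMeasure μ) (C' : ℝ), 0 ≤ C' ∧
      ∀ x, p x ≤ C' * ∫ ω, |ev x ω| ∂μ := by
  let g : X → C(Ω, ℝ) := fun x => C • |ev x| - ContinuousMap.const Ω (p x)
  have hg : ∀ x ω, g x ω = C * |ev x ω| - p x := fun x ω => by simp [g]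
  have hgs : ∀ (c : ℝ) x, 0 ≤ c → g (c • x) = c • g x := by
    intro c x hc
    ext ω
    rw [ContinuousMap.smul_apply, hg, hg, hp c x hc]
    simp [abs_mul, abs_of_nonneg hc]
    ring
  let P : Set C(Ω, ℝ) := {f | ∃ L : List X, f = (L.map g).sum}
  let N : Set C(Ω, ℝ) := {f | Set.MapsTo f Set.univ (Set.Iio 0)}
  have hPsmul : ∀ (c : ℝ) f, 0 ≤ c → f ∈ P → c • f ∈ P := by
    rintro c _ hc ⟨L, rfl⟩
    refine ⟨L.map (c • ·), ?_⟩
    rw [List.smul_sum]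
    simp [List.map_map, Function.comp_def, hgs c _ hc]
  have hPadd : ∀ f f', f ∈ P → f' ∈ P → f + f' ∈ P := by
    rintro _ _ ⟨L, rfl⟩ ⟨L', rfl⟩
    exact ⟨L ++ L', by simp⟩
  have hPconv : Convex ℝ P := fun x hx y hy a b ha hb _ =>
    hPadd _ _ (hPsmul a x ha hx) (hPsmul b y hb hy)
  have hNconv : Convex ℝ N := by
    intro x hx y hy a b ha hb hab ω _
    have h1 : x ω < 0 := hx (Set.mem_univ ω)
    have h2 : y ω < 0 := hy (Set.mem_univ ω)
    change a * x ω + b * y ω < 0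
    rcases ha.lt_or_eq with ha | rfl
    · nlinarith
    · have : b = 1 := by linarith
      subst this
      linarith
  have hNopen : IsOpen N := ContinuousMap.isOpen_setOfPred_mapsTo isCompact_univ isOpen_Iio
  have hdisj : Disjoint N P := by
    rw [Set.disjoint_left]
    rintro f hf ⟨L, rfl⟩
    obtain ⟨ω, hω⟩ := h L.length (fun i => L.get i)
    have h1 : ((L.map g).sum : C(Ω, ℝ)) ω < 0 := hf (Set.mem_univ ω)
    have h2 : ((L.map g).sum : C(Ω, ℝ)) ω =
        C * ∑ i : Fin L.length, |ev (L.get i) ω| - ∑ i : Fin L.length, p (L.get i) := by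
      rw [Finset.mul_sum, ← Finset.sum_sub_distrib]
      simp only [← hg]
      have e : (L.map g).sum = ∑ i : Fin L.length, g (L.get i) := by
        rw [← Fin.sum_univ_fun_getElem L g]
        rfl
      rw [e, ContinuousMap.sum_apply]
    linarith
  obtain ⟨f, u, hfN, hfP⟩ := geometric_hahn_banach_open hNconv hNopen hPconv hdisj
  have hu : u ≤ 0 := by
    have := hfP 0 ⟨[], by simp⟩
    simpa using this
  have hneg : ∀ (k : C(Ω, ℝ)) (t : ℝ), (∀ ω, 0 ≤ k ω) → 0 ≤ t → 0 < t * f k + f 1 := by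
    intro k t hk ht
    have hmem : -(t • k + 1) ∈ N := by
      intro ω _
      have := mul_nonneg ht (hk ω)
      change -(t * k ω + 1) < 0
      linarith
    have := hfN _ hmem
    simp only [map_neg, map_add, map_smul, smul_eq_mul] at this
    linarith
  have hf1 : 0 < f 1 := by
    simpa using hneg 0 0 (fun _ => le_rfl) le_rfl
  have hfpos : ∀ k : C(Ω, ℝ), (∀ ω, 0 ≤ k ω) → 0 ≤ f k := by
    intro k hk
    by_contra hlt
    push Not at hlt
    have := hneg k (f 1 / (- f k)) hk (by apply div_nonneg hf1.le; linarith)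
    have e : f 1 / (- f k) * f k = - f 1 := by
      have : f k ≠ 0 := hlt.ne
      field_simp
    linarith
  have hfPpos : ∀ b ∈ P, 0 ≤ f b := by
    intro b hb
    by_contra hlt
    push Not at hlt
    have := hfP _ (hPsmul ((1 - u) / (- f b)) b
      (by apply div_nonneg <;> linarith) hb)
    rw [map_smul, smul_eq_mul] at this
    have e : (1 - u) / (- f b) * f b = -(1 - u) := by
      have : f b ≠ 0 := hlt.ne
      field_simp
    linarith
  let Λ0 : CompactlySupportedContinuousMap Ω ℝ →ₗ[ℝ] ℝ :=
    { toFun := fun k => f k.toContinuousMap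
      map_add' := fun a b => by rw [← map_add]; rfl
      map_smul' := fun c a => by rw [RingHom.id_apply, ← map_smul]; rfl }
  let Λ : CompactlySupportedContinuousMap Ω ℝ →ₚ[ℝ] ℝ :=
    PositiveLinearMap.mk₀ Λ0 (fun k hk => hfpos _ (fun ω => hk ω))
  have hInt : ∀ k : C(Ω, ℝ), ∫ ω, k ω ∂(RealRMK.rieszMeasure Λ) = f k := by
    intro k
    exact RealRMK.integral_rieszMeasure Λ ⟨k, HasCompactSupport.of_compactSpace _⟩
  refine ⟨RealRMK.rieszMeasure Λ, inferInstance, C / f 1, by positivity, fun x => ?_⟩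
  have h1 := hfPpos (g x) ⟨[x], by simp⟩
  have h2 : f (g x) = C * f |ev x| - p x * f 1 := by
    have : g x = C • |ev x| - p x • (1 : C(Ω, ℝ)) := by ext ω; simp [g]
    rw [this, map_sub, map_smul, map_smul, smul_eq_mul, smul_eq_mul]
  have h3 := hInt |ev x|
  simp only [ContinuousMap.abs_apply] at h3
  rw [h3, div_mul_eq_mul_div, le_div_iff₀ hf1]
  linarith

end pietschaux

section cstaraux

lemma state_nonneg {A : Type*} [CStarAlgebra A] [PartialOrder A] [StarOrderedRing A]
    (φ : StrongDual ℝ A) (h1 : ‖φ‖ ≤ 1) (h2 : φ 1 = 1) (a : A) (ha : 0 ≤ a) : 0 ≤ φ a := by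
  have hle : a ≤ algebraMap ℝ A ‖a‖ :=
    IsSelfAdjoint.le_algebraMap_norm_self (IsSelfAdjoint.of_nonneg ha)
  have h3 : ‖algebraMap ℝ A ‖a‖ - a‖ ≤ ‖a‖ := by
    rw [CStarAlgebra.norm_le_iff_le_algebraMap _ (norm_nonneg a) (sub_nonneg.2 hle)]
    exact sub_le_self _ ha
  have h4 : φ (algebraMap ℝ A ‖a‖ - a) ≤ ‖a‖ := by
    refine (le_abs_self _).trans ?_
    refine (φ.le_of_opNorm_le h1 _).trans ?_
    simpa using h3
  rw [map_sub, Algebra.algebraMap_eq_smul_one, map_smul, h2, smul_eq_mul, mul_one] at h4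
  linarith

lemma exists_state_of_mem {A : Type*} [CStarAlgebra A] [Nontrivial A]
    (y : A) (hy : ‖y‖ ∈ spectrum ℝ y) :
    ∃ φ : StrongDual ℝ A, ‖φ‖ ≤ 1 ∧ φ 1 = 1 ∧ φ y = ‖y‖ := by
  have h1 : 1 + ‖y‖ ∈ spectrum ℝ (1 + y) := by
    have := spectrum.add_mem_add_iff (R := ℝ) (a := y) (r := ‖y‖) (s := 1)
    simpa [add_comm] using this.2 hy
  have h2 : 1 + ‖y‖ ≤ ‖1 + y‖ :=
    (le_abs_self _).trans (spectrum.norm_le_norm_of_mem h1)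
  obtain ⟨φ, hφ, hφ2⟩ := exists_dual_vector'' ℝ (1 + y)
  have h3 : φ 1 ≤ 1 := by
    refine (le_abs_self _).trans ((φ.le_of_opNorm_le hφ _).trans ?_)
    simp
  have h4 : φ y ≤ ‖y‖ := by
    refine (le_abs_self _).trans ((φ.le_of_opNorm_le hφ _).trans ?_)
    simp
  have h5 : φ 1 + φ y = ‖1 + y‖ := by
    rw [← map_add]; exact hφ2
  exact ⟨φ, hφ, by linarith, by linarith⟩

lemma exists_state {A : Type*} [CStarAlgebra A] [Nontrivial A]
    (y : A) (hy : IsSelfAdjoint y) :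
    ∃ φ : StrongDual ℝ A, ‖φ‖ ≤ 1 ∧ φ 1 = 1 ∧ |φ y| = ‖y‖ := by
  rcases CStarAlgebra.norm_or_neg_norm_mem_spectrum hy with h | h
  · obtain ⟨φ, h1, h2, h3⟩ := exists_state_of_mem y h
    exact ⟨φ, h1, h2, by rw [h3, abs_of_nonneg (norm_nonneg _)]⟩
  · have h' : ‖-y‖ ∈ spectrum ℝ (-y) := by
      rw [← spectrum.neg_eq, Set.mem_neg, norm_neg]
      exact h
    obtain ⟨φ, h1, h2, h3⟩ := exists_state_of_mem (-y) h'
    refine ⟨φ, h1, h2, ?_⟩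
    rw [← abs_neg, ← map_neg, h3, norm_neg, abs_of_nonneg (norm_nonneg _)]

/-- The (real) state space of a unital algebra. -/
def stSpace (A : Type*) [CStarAlgebra A] : Set (WeakDual ℝ A) :=
  (WeakDual.toStrongDual ⁻¹' Metric.closedBall (0 : StrongDual ℝ A) 1) ∩ {φ | φ 1 = 1}

lemma stSpace_isCompact (A : Type*) [CStarAlgebra A] : IsCompact (stSpace A) :=
  (WeakDual.isCompact_closedBall (𝕜 := ℝ) (E := A) 0 1).inter_right
    (isClosed_eq (WeakDual.eval_continuous 1) continuous_const)

lemma stSpace_norm {A : Type*} [CStarAlgebra A] (φ : stSpace A) :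
    ‖WeakDual.toStrongDual φ.1‖ ≤ 1 := by
  simpa using φ.2.1

/-- Evaluation of states at selfadjoint elements. -/
noncomputable def stEv (A : Type*) [CStarAlgebra A] : A →ₗ[ℝ] C(stSpace A, ℝ) where
  toFun a := ⟨fun φ => φ.1 a, (WeakDual.eval_continuous a).comp continuous_subtype_val⟩
  map_add' a b := by ext φ; exact map_add φ.1 a b
  map_smul' c a := by ext φ; exact map_smul φ.1 c a

lemma stEv_one {A : Type*} [CStarAlgebra A] (φ : stSpace A) : stEv A 1 φ = 1 := φ.2.2

lemma stEv_nonneg {A : Type*} [CStarAlgebra A] [PartialOrder A] [StarOrderedRing A]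
    (φ : stSpace A) (a : A) (ha : 0 ≤ a) : 0 ≤ stEv A a φ :=
  state_nonneg (WeakDual.toStrongDual φ.1) (stSpace_norm φ) φ.2.2 a ha

lemma stEv_le {A : Type*} [CStarAlgebra A] (φ : stSpace A) (a : A) : |stEv A a φ| ≤ ‖a‖ := by
  have := (WeakDual.toStrongDual φ.1).le_of_opNorm_le (stSpace_norm φ) a
  rw [one_mul] at this
  exact this

lemma stEv_sq_le {A : Type*} [CStarAlgebra A] [PartialOrder A] [StarOrderedRing A]
    (φ : stSpace A) (x : A) (hx : IsSelfAdjoint x) : (stEv A x φ) ^ 2 ≤ stEv A (x * x) φ := by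
  set c := stEv A x φ with hc
  have h1 : IsSelfAdjoint (x - c • (1 : A)) := hx.sub (IsSelfAdjoint.smul (.all c) (.one A))
  have h2 := stEv_nonneg φ _ h1.sq_nonneg
  have h3 : (x - c • (1 : A)) ^ 2 = x * x - (2 * c) • x + (c ^ 2) • (1 : A) := by
    rw [sq, sub_mul, mul_sub, mul_sub, mul_smul_comm, smul_mul_assoc, smul_mul_smul_comm,
      mul_one, mul_one, one_mul]
    module
  rw [h3, map_add, map_sub, map_smul, map_smul] at h2
  simp only [ContinuousMap.add_apply, ContinuousMap.sub_apply, ContinuousMap.smul_apply,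
    stEv_one, smul_eq_mul, ← hc] at h2
  nlinarith

lemma exists_stEv {A : Type*} [CStarAlgebra A] [Nontrivial A]
    (y : A) (hy : IsSelfAdjoint y) : ∃ φ : stSpace A, |stEv A y φ| = ‖y‖ := by
  obtain ⟨φ, h1, h2, h3⟩ := exists_state y hy
  refine ⟨⟨StrongDual.toWeakDual φ, ?_, h2⟩, h3⟩
  simpa using h1

lemma sum_abs_le_states {A : Type*} [CStarAlgebra A] [Nontrivial A] {n : ℕ}
    (x : Fin n → selfAdjoint A) (M : ℝ)
    (hM : ∀ φ : stSpace A, ∑ i, |stEv A (x i) φ| ≤ M) (ψ : A → ℝ)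
    (hadd : ∀ s : Fin n → ℝ, ψ (∑ i, s i • (x i : A)) = ∑ i, s i * ψ (x i))
    (hψ : ∀ a, ψ a ≤ ‖a‖) : ∑ i, |ψ (x i)| ≤ M := by
  let s : Fin n → ℝ := fun i => SignType.sign (ψ (x i))
  have h1 : ∑ i, |ψ (x i)| = ψ (∑ i, s i • (x i : A)) := by
    rw [hadd]
    refine Finset.sum_congr rfl fun i _ => ?_
    exact (sign_mul_self _).symm
  have hsa : IsSelfAdjoint (∑ i, s i • (x i : A)) :=
    isSelfAdjoint_sum _ fun i _ => IsSelfAdjoint.smul (.all (s i)) (x i).2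
  obtain ⟨φ, hφ⟩ := exists_stEv _ hsa
  rw [h1]
  refine (hψ _).trans ?_
  rw [← hφ]
  refine le_trans ?_ (hM φ)
  rw [map_sum, ContinuousMap.sum_apply]
  refine (Finset.abs_sum_le_sum_abs _ _).trans (Finset.sum_le_sum fun i _ => ?_)
  rw [map_smul, ContinuousMap.smul_apply, smul_eq_mul, abs_mul]
  refine mul_le_of_le_one_left (abs_nonneg _) ?_
  simp only [s]
  rcases lt_trichotomy (ψ (x i)) 0 with h | h | h <;> simp [h]

lemma oneSumming_states {A : Type*} [CStarAlgebra A] [Nontrivial A]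
    {E : Type*} [NormedAddCommGroup E] [NormedSpace ℂ E] (T : A →L[ℂ] E) (C : ℝ) (hC : 0 ≤ C)
    (hT : ∀ (n : ℕ) (x : Fin n → A), ∑ i, ‖T (x i)‖ ≤
      C * sSup {r : ℝ | ∃ φ : StrongDual ℂ A, ‖φ‖ ≤ 1 ∧ r = ∑ i, ‖φ (x i)‖})
    (n : ℕ) (x : Fin n → selfAdjoint A) :
    ∃ φ : stSpace A, ∑ i, ‖T (x i)‖ ≤ (2 * C) * ∑ i, |stEv A (x i) φ| := by
  haveI : CompactSpace (stSpace A) := isCompact_iff_compactSpace.1 (stSpace_isCompact A)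
  have hne : (Set.univ : Set (stSpace A)).Nonempty := by
    obtain ⟨φ, -⟩ := exists_stEv (1 : A) (.one A)
    exact ⟨φ, trivial⟩
  obtain ⟨φ, -, hφ⟩ := isCompact_univ.exists_isMaxOn hne
    (f := fun φ : stSpace A => ∑ i, |stEv A (x i) φ|)
    (Continuous.continuousOn (continuous_finset_sum _ fun i _ => (stEv A (x i)).continuous.abs))
  refine ⟨φ, (hT n fun i => x i).trans ?_⟩
  have hmax : ∀ χ : stSpace A, ∑ i, |stEv A (x i) χ| ≤ ∑ i, |stEv A (x i) φ| :=
    fun χ => hφ (Set.mem_univ χ)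
  rw [mul_comm 2 C, mul_assoc]
  refine mul_le_mul_of_nonneg_left ?_ hC
  refine Real.sSup_le ?_ (by positivity)
  rintro r ⟨f, hf, rfl⟩
  have hfa : ∀ a, ‖f a‖ ≤ ‖a‖ := fun a => by simpa using f.le_of_opNorm_le hf a
  have hsm : ∀ (c : ℝ) (a : A), f (c • a) = (c : ℂ) * f a := fun c a => by
    rw [← Complex.coe_smul, map_smul, smul_eq_mul]
  have hre := sum_abs_le_states x _ hmax (fun a => (f a).re)
    (fun s => by simp [map_sum, hsm])
    (fun a => (Complex.re_le_norm _).trans (hfa a))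
  have him := sum_abs_le_states x _ hmax (fun a => (f a).im)
    (fun s => by simp [map_sum, hsm])
    (fun a => (le_abs_self _).trans ((Complex.abs_im_le_norm _).trans (hfa a)))
  have := Finset.sum_le_sum (s := Finset.univ)
    fun i (_ : i ∈ Finset.univ) => Complex.norm_le_abs_re_add_abs_im (f (x i))
  rw [Finset.sum_add_distrib] at this
  linarith

lemma main_selfAdjoint {A : Type*} [CStarAlgebra A] [PartialOrder A] [StarOrderedRing A]
    [Nontrivial A]
    {E : Type*} [NormedAddCommGroup E] [NormedSpace ℂ E] [CompleteSpace E] (hE : HasCRP E)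
    (T : A →L[ℂ] E) (hT : OneSumming T) :
    TotallyBounded ((fun x : selfAdjoint A => T x) '' {x | ‖x‖ ≤ 1}) := by
  obtain ⟨C, hC, hT⟩ := hT
  haveI : CompactSpace (stSpace A) := isCompact_iff_compactSpace.1 (stSpace_isCompact A)
  letI : MeasurableSpace (stSpace A) := borel _
  haveI : BorelSpace (stSpace A) := ⟨rfl⟩
  let ι : selfAdjoint A →ₗ[ℝ] A := (selfAdjoint.submodule ℝ A).subtype
  let ev : selfAdjoint A →ₗ[ℝ] C(stSpace A, ℝ) := stEv A ∘ₗ ι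
  let T' : selfAdjoint A →ₗ[ℝ] E := (T.restrictScalars ℝ).toLinearMap ∘ₗ ι
  have hev : ∀ x : selfAdjoint A, ev x = stEv A (x : A) := fun x => rfl
  obtain ⟨μ, hμ, C', hC', hdom⟩ := pietsch_domination ev (fun x => ‖T' x‖)
    (fun c x hc => by rw [map_smul, norm_smul, Real.norm_of_nonneg hc]) (2 * C) (by positivity)
    (fun n x => oneSumming_states T C hC hT n x)
  have hInt : ∀ a : A, Integrable (fun φ => stEv A a φ) μ := fun a =>
    (stEv A a).continuous.integrable_of_hasCompactSupport (HasCompactSupport.of_compactSpace _)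
  let F : A →ₗ[ℝ] ℝ :=
    { toFun := fun a => ∫ φ, stEv A a φ ∂μ
      map_add' := fun a b => by
        rw [← integral_add (hInt a) (hInt b)]; simp
      map_smul' := fun c a => by
        rw [RingHom.id_apply, smul_eq_mul, ← integral_const_mul]; simp }
  have hF : ∀ a, F a = ∫ φ, stEv A a φ ∂μ := fun a => rfl
  let B : selfAdjoint A →ₗ[ℝ] selfAdjoint A →ₗ[ℝ] ℝ :=
    LinearMap.mk₂ ℝ (fun x y => (F ((x : A) * y) + F ((y : A) * x)) / 2)
      (fun x y z => by simp only [AddSubgroup.coe_add, add_mul, mul_add, map_add]; ring)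
      (fun c x y => by
        simp only [selfAdjoint.val_smul, smul_mul_assoc, mul_smul_comm, map_smul, smul_eq_mul]
        ring)
      (fun x y z => by simp only [AddSubgroup.coe_add, add_mul, mul_add, map_add]; ring)
      (fun c x y => by
        simp only [selfAdjoint.val_smul, smul_mul_assoc, mul_smul_comm, map_smul, smul_eq_mul]
        ring)
  have hB : ∀ x y, B x y = (F ((x : A) * y) + F ((y : A) * x)) / 2 := fun x y => rfl
  have hBs : ∀ x, B x x = F ((x : A) * x) := fun x => by rw [hB]; ring
  have key := abstract_compact hE μ ev B (fun x y => by rw [hB, hB]; ring)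
    (fun x => by
      rw [hBs, hF]
      refine integral_mono ?_ (hInt _) fun φ => stEv_sq_le φ x x.2
      exact ((ev x).continuous.pow 2).integrable_of_hasCompactSupport
        (HasCompactSupport.of_compactSpace _))
    (fun x => by
      have hp := CFC.posPart_nonneg (x : A)
      have hq := CFC.negPart_nonneg (x : A)
      refine ⟨⟨(x : A)⁺, IsSelfAdjoint.of_nonneg hp⟩, ⟨(x : A)⁻, IsSelfAdjoint.of_nonneg hq⟩,
        ?_, ?_, fun φ => stEv_nonneg φ _ hp, fun φ => stEv_nonneg φ _ hq⟩
      · ext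
        exact (CFC.posPart_sub_negPart (x : A) x.2).symm
      · rw [hB]
        simp only [CFC.posPart_mul_negPart, CFC.negPart_mul_posPart, map_zero]
        simp)
    T' C' hC' hdom
  set m : ℝ := μ.real Set.univ with hm
  have hm0 : 0 ≤ m := measureReal_nonneg
  have hbd : ∀ x : selfAdjoint A, ‖x‖ ≤ 1 → B x x ≤ m := by
    intro x hx
    rw [hBs, hF]
    have : ∫ φ, stEv A ((x : A) * x) φ ∂μ ≤ ∫ φ, (1 : ℝ) ∂μ := by
      refine integral_mono (hInt _) (integrable_const _) fun φ => ?_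
      refine (le_abs_self _).trans ((stEv_le φ _).trans ((norm_mul_le _ _).trans ?_))
      have hx' : ‖(x : A)‖ ≤ 1 := hx
      exact mul_le_one₀ hx' (norm_nonneg _) hx'
    simpa [hm] using this
  have h2 := key.image (uniformContinuous_const_smul (m + 1))
  refine h2.subset ?_
  rintro _ ⟨x, hx, rfl⟩
  have hm1 : (m + 1) ≠ 0 := by positivity
  refine ⟨T' ((m + 1)⁻¹ • x), ⟨(m + 1)⁻¹ • x, ?_, rfl⟩, ?_⟩
  · change B _ _ ≤ 1
    rw [map_smul, map_smul, LinearMap.smul_apply, smul_eq_mul, smul_eq_mul, ← mul_assoc,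
      ← mul_inv, inv_mul_le_iff₀ (by positivity)]
    have := hbd x hx
    nlinarith
  · change (m + 1) • T' ((m + 1)⁻¹ • x) = T' x
    rw [map_smul, smul_inv_smul₀ hm1]

lemma main_cstar {A : Type*} [CStarAlgebra A] [PartialOrder A] [StarOrderedRing A]
    [Nontrivial A]
    {E : Type*} [NormedAddCommGroup E] [NormedSpace ℂ E] [CompleteSpace E] (hE : HasCRP E)
    (T : A →L[ℂ] E) (hT : OneSumming T) : IsCompactOperator T := by
  have hS := main_selfAdjoint hE T hT
  set S := (fun x : selfAdjoint A => T x) '' {x | ‖x‖ ≤ 1} with hSdef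
  have hK : IsCompact (closure S) :=
    hS.closure.isCompact_of_isClosed isClosed_closure
  have hK2 : IsCompact ((fun p : E × E => p.1 + Complex.I • p.2) '' (closure S ×ˢ closure S)) :=
    (hK.prod hK).image (by fun_prop)
  refine (isCompactOperator_iff_isCompact_closure_image_closedBall T.toLinearMap one_pos).2 ?_
  refine hK2.closure_of_subset ?_
  rintro _ ⟨a, ha, rfl⟩
  have ha' : ‖a‖ ≤ 1 := by simpa using ha
  refine ⟨(T (realPart a : A), T (imaginaryPart a : A)),
    ⟨subset_closure ⟨realPart a, (realPart.norm_le a).trans ha', rfl⟩,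
      subset_closure ⟨imaginaryPart a, (imaginaryPart.norm_le a).trans ha', rfl⟩⟩, ?_⟩
  change T _ + Complex.I • T _ = T a
  rw [← map_smul, ← map_add, realPart_add_I_smul_imaginaryPart]

end cstaraux

/-- If `𝒜` is a C*-algebra, `E` is a Banach space with the compact range property and
`T : 𝒜 → E` is `1`-summing, then `T` is compact. -/
theorem oneSumming_cstarAlgebra_isCompactOperator_of_hasCRP
    {A : Type*} [NormedRing A] [StarRing A] [CStarRing A] [NormedAlgebra ℂ A]
    [CompleteSpace A] [StarModule ℂ A]
    {E : Type*} [NormedAddCommGroup E] [NormedSpace ℂ E] [CompleteSpace E]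
    (hE : HasCRP E) (T : A →L[ℂ] E) (hT : OneSumming T) :
    IsCompactOperator T := by
  letI : CStarAlgebra A := {}
  letI := CStarAlgebra.spectralOrder A
  haveI := CStarAlgebra.spectralOrderedRing A
  rcases subsingleton_or_nontrivial A with h | h
  · have : (T : A → E) = 0 := by
      ext a
      rw [Subsingleton.elim a 0, map_zero]
      rfl
    rw [this]
    exact isCompactOperator_zero
  · exact main_cstar hE T hT
end

section
/- For a Banach space E the following are equivalent: (1) E has the compact range property (CRP); (2) every 1-summing operator T : C[0,1] → E is compact; (3) for every C*-algebra 𝒜, every 1-summing operator T : 𝒜 → E is compact. -/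
open MeasureTheory ENNReal

section PartOne

lemma crpAux_isCompact_closure {E : Type*} [NormedAddCommGroup E] (S : Set E)
    (h : ∀ u : ℕ → E, (∀ n, u n ∈ S) → ∃ K : Set E, IsCompact K ∧ ∀ n, u n ∈ K) :
    IsCompact (closure S) := by
  apply IsSeqCompact.isCompact
  intro w hw
  have : ∀ n : ℕ, ∃ u ∈ S, dist (w n) u < 1 / ((n : ℝ) + 1) := fun n =>
    Metric.mem_closure_iff.1 (hw n) _ Nat.one_div_pos_of_nat
  choose u hu hd using this
  obtain ⟨K, hK, huK⟩ := h u hu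
  obtain ⟨a, -, φ, hφ, ha⟩ := hK.tendsto_subseq huK
  have h0 : Filter.Tendsto (fun n => dist (u (φ n)) (w (φ n))) Filter.atTop (nhds 0) := by
    have : Filter.Tendsto (fun n : ℕ => 1 / ((n : ℝ) + 1)) Filter.atTop (nhds 0) :=
      tendsto_one_div_add_atTop_nhds_zero_nat
    refine squeeze_zero (fun _ => dist_nonneg) (fun n => ?_) (this.comp hφ.tendsto_atTop)
    rw [dist_comm]
    exact (hd _).le
  have h1 : Filter.Tendsto (w ∘ φ) Filter.atTop (nhds a) := (tendsto_iff_of_dist h0).1 ha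
  exact ⟨a, isClosed_closure.mem_of_tendsto h1 (Filter.Eventually.of_forall fun n => hw _),
    φ, hφ, h1⟩

lemma crpAux_variation_lt_top {α : Type*} [MeasurableSpace α] {E : Type*} [NormedAddCommGroup E]
    (ν : VectorMeasure α E) (h : BoundedVariationVM ν) : ν.variation Set.univ < ∞ := by
  obtain ⟨C, hC⟩ := h
  refine lt_of_le_of_lt ?_ (ENNReal.ofReal_lt_top (r := C))
  by_contra hlt
  push Not at hlt
  obtain ⟨P, -, hP2, hP3, hP4⟩ := ν.exists_lt_sum_of_lt_variation MeasurableSet.univ hlt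
  have key := hC P.card (fun i => (P.equivFin.symm i : Set α)) (fun i => hP3 _ (P.equivFin.symm i).2)
    (fun i j hij => hP2 (P.equivFin.symm i).2 (P.equivFin.symm j).2
      (fun h => hij (P.equivFin.symm.injective (Subtype.ext h))))
  have h2 : ∑ i, ‖ν (P.equivFin.symm i : Set α)‖ = ∑ p ∈ P, ‖ν p‖ := by
    rw [Equiv.sum_comp P.equivFin.symm (fun p : P => ‖ν (p : Set α)‖)]
    exact Finset.sum_coe_sort P (fun p => ‖ν p‖)
  rw [h2] at key
  refine absurd hP4 (not_lt.2 ?_)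
  calc ∑ p ∈ P, ‖ν p‖ₑ = ∑ p ∈ P, ENNReal.ofReal ‖ν p‖ := by simp
    _ = ENNReal.ofReal (∑ p ∈ P, ‖ν p‖) := (ENNReal.ofReal_sum_of_nonneg (by simp)).symm
    _ ≤ _ := ENNReal.ofReal_le_ofReal key

/-- The set function `s ↦ (c ↦ c • ν s)`. -/
noncomputable def crpAuxSet {α : Type*} [MeasurableSpace α] {E : Type*} [NormedAddCommGroup E]
    [NormedSpace ℂ E] (ν : VectorMeasure α E) (s : Set α) : ℂ →L[ℝ] E :=
  (ContinuousLinearMap.toSpanSingleton ℂ (ν s)).restrictScalars ℝ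

lemma crpAuxSet_dom {α : Type*} [MeasurableSpace α] {E : Type*} [NormedAddCommGroup E]
    [NormedSpace ℂ E] (ν : VectorMeasure α E) (h : ν.variation Set.univ < ∞) :
    DominatedFinMeasAdditive ν.variation (crpAuxSet ν) 1 := by
  constructor
  · intro s t hs ht _ _ hst
    ext
    simp [crpAuxSet, ν.of_union hst hs ht]
  · intro s hs hμ
    rw [one_mul]
    refine le_trans ?_ (VectorMeasure.norm_measure_le_variation hμ.ne)
    refine ContinuousLinearMap.opNorm_le_bound _ (norm_nonneg _) fun x => ?_
    simp [crpAuxSet, norm_smul, mul_comm]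

/-- A vector measure of bounded variation on `[0,1]` has relatively compact range
if all 1-summing operators on `C[0,1]` are compact. -/
lemma crpAux_interval {E : Type*} [NormedAddCommGroup E] [NormedSpace ℂ E] [CompleteSpace E]
    (h2 : ∀ T : C(Set.Icc (0:ℝ) 1, ℂ) →L[ℂ] E, OneSumming T → IsCompactOperator T)
    (ν : VectorMeasure (Set.Icc (0:ℝ) 1) E) (hν : ν.variation Set.univ < ∞) :
    ∃ K : Set E, IsCompact K ∧ ∀ s, MeasurableSet s → ν s ∈ K := by
  have hdom := crpAuxSet_dom ν hν
  set μ := ν.variation with hμ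
  haveI : IsFiniteMeasure μ := ⟨hν⟩
  have hInteg : ∀ f : C(Set.Icc (0:ℝ) 1, ℂ), Integrable f μ := fun f =>
    f.continuous.integrable_of_hasCompactSupport (HasCompactSupport.of_compactSpace _)
  have hbound : ∀ f : (Set.Icc (0:ℝ) 1) → ℂ, Integrable f μ →
      ‖setToFun μ (crpAuxSet ν) hdom f‖ ≤ ∫ t, ‖f t‖ ∂μ := by
    intro f hf
    have := norm_setToFun_le hdom hf zero_le_one
    rwa [one_mul, L1.norm_of_fun_eq_integral_norm] at this
  let T0 : C(Set.Icc (0:ℝ) 1, ℂ) →ₗ[ℂ] E :=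
    { toFun := fun f => setToFun μ (crpAuxSet ν) hdom f
      map_add' := fun f g => setToFun_add hdom (hInteg f) (hInteg g)
      map_smul' := fun c f => setToFun_smul hdom (fun c s x => by simp [crpAuxSet, mul_smul]) c f }
  let T : C(Set.Icc (0:ℝ) 1, ℂ) →L[ℂ] E := T0.mkContinuous (μ.real Set.univ) (by
    intro f
    refine (hbound f (hInteg f)).trans ?_
    calc ∫ t, ‖f t‖ ∂μ ≤ ∫ t, ‖f‖ ∂μ :=
          integral_mono (hInteg f).norm (integrable_const _) (fun t => f.norm_coe_le_norm t)
      _ = _ := by simp)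
  have hT : ∀ f, T f = setToFun μ (crpAuxSet ν) hdom f := fun f => rfl
  have hsum : OneSumming T := by
    refine ⟨μ.real Set.univ, measureReal_nonneg, fun n x => ?_⟩
    set S := {r : ℝ | ∃ φ : StrongDual ℂ C(Set.Icc (0:ℝ) 1, ℂ), ‖φ‖ ≤ 1 ∧ r = ∑ i, ‖φ (x i)‖}
    have hS : BddAbove S := by
      refine ⟨∑ i, ‖x i‖, ?_⟩
      rintro r ⟨φ, hφ, rfl⟩
      refine Finset.sum_le_sum fun i _ => ?_
      calc ‖φ (x i)‖ ≤ ‖φ‖ * ‖x i‖ := φ.le_opNorm _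
        _ ≤ 1 * ‖x i‖ := by gcongr
        _ = _ := one_mul _
    have hle : ∀ t, ∑ i, ‖x i t‖ ≤ sSup S := by
      intro t
      refine le_csSup hS ⟨ContinuousMap.evalCLM ℂ t, ?_, by simp⟩
      refine ContinuousLinearMap.opNorm_le_bound _ zero_le_one fun f => ?_
      simpa using f.norm_coe_le_norm t
    calc ∑ i, ‖T (x i)‖ ≤ ∑ i, ∫ t, ‖x i t‖ ∂μ :=
          Finset.sum_le_sum fun i _ => hbound _ (hInteg _)
      _ = ∫ t, ∑ i, ‖x i t‖ ∂μ := (integral_finsetSum _ fun i _ => (hInteg _).norm).symm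
      _ ≤ ∫ t, sSup S ∂μ := integral_mono (integrable_finsetSum _ fun i _ => (hInteg _).norm)
          (integrable_const _) hle
      _ = _ := by simp
  have hc := (h2 T hsum).isCompact_closure_image_closedBall 1
  refine ⟨_, hc, fun s hs => ?_⟩
  rw [Metric.mem_closure_iff]
  intro ε hε
  obtain ⟨F, hFs, hF, hFμ⟩ := hs.exists_isClosed_sdiff_lt (μ := μ) (measure_ne_top _ _)
    (ε := ENNReal.ofReal (ε / 2)) (by simpa using hε)
  obtain ⟨f, hf, hfF, hf1, -, -⟩ := exists_continuous_eLpNorm_sub_le_of_closed (μ := μ)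
    (p := 1) (by simp) hF isOpen_univ (Set.subset_univ _) (measure_ne_top _ _) (1 : ℂ)
    (ε := ENNReal.ofReal (ε / 4)) (by simpa using hε)
  let g : C(Set.Icc (0:ℝ) 1, ℂ) := ⟨f, hf⟩
  refine ⟨T g, ⟨g, ?_, rfl⟩, ?_⟩
  · rw [mem_closedBall_zero_iff, ContinuousMap.norm_le _ zero_le_one]
    intro t; exact (hf1 t).trans (by simp)
  · have hFm := hF.measurableSet
    have e1 : ν s - ν F = ν (s \ F) := by
      rw [← ν.of_add_of_sdiff hFm hs hFs]; abel
    have b1 : ‖ν s - ν F‖ < ε / 2 := by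
      rw [e1]
      refine (VectorMeasure.norm_measure_le_variation (measure_ne_top μ _)).trans_lt ?_
      rw [measureReal_def]
      exact (ENNReal.lt_ofReal_iff_toReal_lt (measure_ne_top _ _)).1 hFμ
    have hi : Integrable (F.indicator fun _ => (1 : ℂ)) μ :=
      (integrable_const _).indicator hFm
    have e2 : ν F = setToFun μ (crpAuxSet ν) hdom (F.indicator fun _ => (1 : ℂ)) := by
      rw [setToFun_indicator_const hdom hFm (measure_ne_top _ _)]
      simp [crpAuxSet]
    have b2 : ‖T g - ν F‖ ≤ ε / 4 := by
      rw [e2, hT, ← setToFun_sub hdom (hInteg g) hi]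
      refine (hbound _ ((hInteg g).sub hi)).trans ?_
      rw [integral_norm_eq_lintegral_enorm ((hInteg g).sub hi).aestronglyMeasurable]
      rw [eLpNorm_one_eq_lintegral_enorm] at hfF
      exact ENNReal.toReal_le_of_le_ofReal (by positivity) hfF
    rw [dist_eq_norm]
    calc ‖ν s - T g‖ = ‖(ν s - ν F) - (T g - ν F)‖ := by congr 1; abel
      _ ≤ ‖ν s - ν F‖ + ‖T g - ν F‖ := norm_sub_le _ _
      _ < ε := by linarith

lemma crpAux_two_one {E : Type*} [NormedAddCommGroup E] [NormedSpace ℂ E] [CompleteSpace E]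
    (h2 : ∀ T : C(Set.Icc (0:ℝ) 1, ℂ) →L[ℂ] E, OneSumming T → IsCompactOperator T) :
    HasCRP E := by
  classical
  intro α _ ν hν
  have hv := crpAux_variation_lt_top ν hν
  apply crpAux_isCompact_closure
  intro u hu
  have : ∀ n, ∃ B, MeasurableSet B ∧ ν B = u n := by
    intro n
    obtain ⟨B, hB⟩ := hu n
    by_cases hm : MeasurableSet B
    · exact ⟨B, hm, hB⟩
    · exact ⟨∅, MeasurableSet.empty, by rw [← hB, ν.not_measurable hm, ν.empty]⟩
  choose B hBm hB using this
  have hunc : ¬ Countable (Set.Icc (0:ℝ) 1) := by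
    rw [Set.countable_coe_iff, ← Cardinal.le_aleph0_iff_set_countable,
      Cardinal.mk_Icc_real zero_lt_one, not_le]
    exact Cardinal.aleph0_lt_continuum
  let e := PolishSpace.measurableEquivNatBoolOfNotCountable hunc
  let h : α → (ℕ → Bool) := fun x n => decide (x ∈ B n)
  have hh : Measurable h := by
    refine measurable_pi_iff.2 fun n => measurable_to_bool ?_
    convert hBm n using 1
    ext x; simp [h]
  have hm : Measurable (fun x => e.symm (h x)) := e.symm.measurable.comp hh
  have hC : ∀ n, MeasurableSet {t | e t n = true} := fun n =>
    (measurable_pi_apply n |>.comp e.measurable) (measurableSet_singleton true)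
  have hv' : (ν.map (fun x => e.symm (h x))).variation Set.univ < ∞ := by
    refine lt_of_le_of_lt (VectorMeasure.variation_map_le _) ?_
    rwa [Measure.map_apply hm MeasurableSet.univ]
  obtain ⟨K, hK, hKs⟩ := crpAux_interval h2 _ hv'
  refine ⟨K, hK, fun n => ?_⟩
  have := hKs _ (hC n)
  rw [VectorMeasure.map_apply _ hm (hC n)] at this
  convert this using 1
  rw [← hB]
  congr 1
  ext x
  simp [h]

end PartOne

section PartTwo

open scoped Pointwise

variable {K : Type} [MeasurableSpace K] (μ : Measure K) [IsProbabilityMeasure μ]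

open Classical in
/-- The indicator function of a set, as an element of `L²`. -/
noncomputable def crpInd (s : Set K) : Lp ℝ 2 μ :=
  if h : MeasurableSet s then indicatorConstLp 2 h (measure_ne_top μ s) (1 : ℝ) else 0

lemma crpInd_inner {s : Set K} (hs : MeasurableSet s) (k : Lp ℝ 2 μ) :
    inner ℝ k (crpInd μ s) = ∫ x in s, k x ∂μ := by
  rw [crpInd, dif_pos hs, real_inner_comm, L2.inner_indicatorConstLp_one]

lemma crp_dual {E : Type*} [NormedAddCommGroup E] [NormedSpace ℝ E]
    (S : Lp ℝ 2 μ →L[ℝ] E) (f : StrongDual ℝ E) :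
    ∃ k : Lp ℝ 2 μ, ∀ g, f (S g) = inner ℝ k g := by
  refine ⟨(InnerProductSpace.toDual ℝ (Lp ℝ 2 μ)).symm (f.comp S), fun g => ?_⟩
  simp

lemma crp_hasSum {E : Type*} [NormedAddCommGroup E] [NormedSpace ℝ E] [CompleteSpace E]
    (S : Lp ℝ 2 μ →L[ℝ] E) (C : ℝ) (hS : ∀ s, ‖S (crpInd μ s)‖ ≤ C * μ.real s)
    (f : ℕ → Set K) (hf : ∀ i, MeasurableSet (f i)) (hd : Pairwise (Function.onFun Disjoint f)) :
    HasSum (fun i => S (crpInd μ (f i))) (S (crpInd μ (⋃ i, f i))) := by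
  have hsum : Summable (fun i => μ.real (f i)) := by
    have := ENNReal.summable_toReal (f := fun i => μ (f i))
      (by rw [← measure_iUnion hd hf]; exact measure_ne_top _ _)
    exact this
  have hs : Summable (fun i => S (crpInd μ (f i))) :=
    Summable.of_norm_bounded (hsum.mul_left C) (fun i => hS _)
  obtain ⟨e, he⟩ := hs
  suffices h : S (crpInd μ (⋃ i, f i)) = e by rw [h]; exact he
  refine (SeparatingDual.eq_iff_forall_dual_eq (R := ℝ)).2 fun ℓ => ?_
  obtain ⟨k, hk⟩ := crp_dual μ S ℓ
  have h1 := he.mapL ℓ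
  simp only [hk, crpInd_inner μ (hf _)] at h1
  rw [hk, crpInd_inner μ (MeasurableSet.iUnion hf)]
  have hki : Integrable k μ := (Lp.memLp k).integrable (by norm_num)
  exact (hasSum_integral_iUnion hf hd hki.integrableOn).unique h1

lemma crp_totallyBounded_unit {E : Type*} [NormedAddCommGroup E] [NormedSpace ℝ E]
    [CompleteSpace E] (hE : HasCRP E)
    (S : Lp ℝ 2 μ →L[ℝ] E) (C : ℝ) (hS : ∀ s, ‖S (crpInd μ s)‖ ≤ C * μ.real s) :
    TotallyBounded (S '' {g | 0 ≤ g ∧ g ≤ crpInd μ Set.univ}) := by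
  let ν : VectorMeasure K E :=
    { measureOf' := fun s => S (crpInd μ s)
      empty' := by
        have := hS ∅
        simpa using this
      not_measurable' := fun s hs => by rw [crpInd, dif_neg hs, map_zero]
      m_iUnion' := fun f hf hd => crp_hasSum μ S C hS f hf hd }
  have hν : ∀ s, ν s = S (crpInd μ s) := fun s => rfl
  have hC : 0 ≤ C := by
    have := (norm_nonneg _).trans (hS Set.univ)
    simpa using this
  have hbv : BoundedVariationVM ν := by
    refine ⟨C, fun n s hs hd => ?_⟩
    calc ∑ i, ‖ν (s i)‖ ≤ ∑ i, C * μ.real (s i) := Finset.sum_le_sum fun i _ => hS _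
      _ = C * μ.real (⋃ i, s i) := by
        rw [← Finset.mul_sum, measureReal_iUnion_fintype hd hs]
      _ ≤ C * 1 := by gcongr; exact measureReal_le_one
      _ = C := mul_one C
  have hcomp := hE K _ ν hbv
  have htb : TotallyBounded (closure (convexHull ℝ (Set.range ν))) :=
    (TotallyBounded.convexHull (hcomp.totallyBounded.subset subset_closure)).closure
  refine htb.subset ?_
  rintro _ ⟨g, ⟨hg0, hg1⟩, rfl⟩
  by_contra hcon
  obtain ⟨f, u, hu1, hu2⟩ := geometric_hahn_banach_closed_point
    (convex_convexHull ℝ (Set.range ν)).closure isClosed_closure hcon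
  obtain ⟨k, hk⟩ := crp_dual μ S f
  have hki : Integrable k μ := (Lp.memLp k).integrable (by norm_num)
  have hm : MeasurableSet {x | 0 ≤ k x} :=
    measurableSet_le measurable_const (Lp.stronglyMeasurable k).measurable
  have h1 := hu1 (ν {x | 0 ≤ k x}) (subset_closure (subset_convexHull ℝ _ ⟨_, rfl⟩))
  rw [hν, hk, crpInd_inner μ hm] at h1
  rw [hk, L2.inner_def] at hu2
  have h2 : ∫ x, inner ℝ (k x) (g x) ∂μ ≤ ∫ x in {x | 0 ≤ k x}, k x ∂μ := by
    rw [← integral_indicator hm]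
    refine integral_mono_ae (L2.integrable_inner k g) (hki.indicator hm) ?_
    have hg0' := (Lp.coeFn_nonneg g).2 hg0
    have hg1' := (Lp.coeFn_le g _).2 hg1
    rw [crpInd, dif_pos MeasurableSet.univ] at hg1'
    filter_upwards [hg0', hg1', indicatorConstLp_coeFn (p := 2) (hs := MeasurableSet.univ)
      (hμs := measure_ne_top μ Set.univ) (c := (1 : ℝ))] with x h0 h1 h2
    rw [h2] at h1
    simp only [Set.indicator_univ, Pi.zero_apply] at h0 h1
    simp only [Set.indicator, Set.mem_ofPred_eq]
    have : inner ℝ (k x) (g x) = g x * k x := by simp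
    rw [this]
    split_ifs with h
    · nlinarith
    · push Not at h; nlinarith
  linarith

lemma crp_smul_nonneg {r : ℝ} (hr : 0 ≤ r) {g : Lp ℝ 2 μ} (hg : 0 ≤ g) : 0 ≤ r • g := by
  rw [← Lp.coeFn_nonneg] at hg ⊢
  filter_upwards [hg, Lp.coeFn_smul r g] with x h1 h2
  rw [h2]
  exact mul_nonneg hr h1

lemma crp_totallyBounded_sym {E : Type*} [NormedAddCommGroup E] [NormedSpace ℝ E]
    [CompleteSpace E] (hE : HasCRP E)
    (S : Lp ℝ 2 μ →L[ℝ] E) (C : ℝ) (hS : ∀ s, ‖S (crpInd μ s)‖ ≤ C * μ.real s) :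
    ∃ W : Set E, IsCompact W ∧ ∀ (r : ℝ), 0 < r → ∀ g, -(r • crpInd μ Set.univ) ≤ g →
      g ≤ r • crpInd μ Set.univ → S g ∈ r • W := by
  have h := crp_totallyBounded_unit μ hE S C hS
  have hc : IsCompact (closure (S '' {g | 0 ≤ g ∧ g ≤ crpInd μ Set.univ})) :=
    h.closure.isCompact_of_isClosed isClosed_closure
  refine ⟨(fun w => (2 : ℝ) • w - S (crpInd μ Set.univ)) ''
    closure (S '' {g | 0 ≤ g ∧ g ≤ crpInd μ Set.univ}), hc.image (by fun_prop), ?_⟩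
  intro r hr g h1 h2
  set o := crpInd μ Set.univ
  refine Set.mem_smul_set.2 ⟨_, ⟨S ((2:ℝ)⁻¹ • (r⁻¹ • g + o)), subset_closure ⟨_, ⟨?_, ?_⟩, rfl⟩, rfl⟩, ?_⟩
  · have : 0 ≤ r⁻¹ • (g + r • o) := crp_smul_nonneg μ (by positivity) (by
      rw [neg_le_iff_add_nonneg] at h1; exact h1)
    rw [smul_add, inv_smul_smul₀ hr.ne'] at this
    exact crp_smul_nonneg μ (by positivity) this
  · have : 0 ≤ r⁻¹ • (r • o - g) := crp_smul_nonneg μ (by positivity) (sub_nonneg.2 h2)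
    rw [smul_sub, inv_smul_smul₀ hr.ne'] at this
    have h3 : 0 ≤ (2:ℝ)⁻¹ • (o - r⁻¹ • g) := crp_smul_nonneg μ (by positivity) this
    rw [← sub_nonneg]
    convert h3 using 1
    module
  · simp only [map_smul, map_add]
    rw [smul_inv_smul₀ two_ne_zero, add_sub_cancel_right, smul_inv_smul₀ hr.ne']

end PartTwo

section PartThree

open scoped Pointwise InnerProduct

variable {K : Type} [MeasurableSpace K] (μ : Measure K) [IsProbabilityMeasure μ]

lemma crpInd_nonneg (s : Set K) : 0 ≤ crpInd μ s := by
  by_cases hs : MeasurableSet s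
  · rw [crpInd, dif_pos hs, ← Lp.coeFn_nonneg]
    filter_upwards [indicatorConstLp_coeFn (p := 2) (hs := hs)
      (hμs := measure_ne_top μ s) (c := (1 : ℝ))] with x hx
    rw [hx]
    exact Set.indicator_nonneg (fun _ _ => zero_le_one) x
  · rw [crpInd, dif_neg hs]

lemma crpInd_univ_coe : crpInd μ Set.univ =ᵐ[μ] fun _ => (1 : ℝ) := by
  rw [crpInd, dif_pos MeasurableSet.univ]
  filter_upwards [indicatorConstLp_coeFn (p := 2) (hs := MeasurableSet.univ)
      (hμs := measure_ne_top μ Set.univ) (c := (1 : ℝ))] with x hx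
  rw [hx]; simp

lemma crpInd_inner_univ {s : Set K} (hs : MeasurableSet s) :
    inner ℝ (crpInd μ Set.univ) (crpInd μ s) = μ.real s := by
  rw [crpInd_inner μ hs]
  rw [setIntegral_congr_ae (g := fun _ => (1:ℝ)) hs
    (by filter_upwards [crpInd_univ_coe μ] with x hx _ using hx)]
  simp

lemma crpInd_univ_norm : ‖crpInd μ Set.univ‖ = 1 := by
  have h := crpInd_inner_univ μ (MeasurableSet.univ)
  rw [real_inner_self_eq_norm_sq] at h
  have : ‖crpInd μ Set.univ‖ ^ 2 = 1 := by rw [h]; simp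
  nlinarith [norm_nonneg (crpInd μ Set.univ)]

lemma crp_totallyBounded_of_approx {E : Type*} [NormedAddCommGroup E] (s : Set E)
    (h : ∀ ε > 0, ∃ W : Set E, IsCompact W ∧ ∀ x ∈ s, ∃ w ∈ W, ‖x - w‖ < ε) :
    TotallyBounded s := by
  rw [Metric.totallyBounded_iff]
  intro ε hε
  obtain ⟨W, hW, hs⟩ := h (ε / 2) (by positivity)
  obtain ⟨t, ht, htW⟩ := Metric.totallyBounded_iff.1 hW.totallyBounded (ε / 2) (by positivity)
  refine ⟨t, ht, fun x hx => ?_⟩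
  obtain ⟨w, hw, hxw⟩ := hs x hx
  obtain ⟨y, hy, hwy⟩ := Set.mem_iUnion₂.1 (htW hw)
  refine Set.mem_iUnion₂.2 ⟨y, hy, ?_⟩
  rw [Metric.mem_ball] at *
  rw [← dist_eq_norm] at hxw
  linarith [dist_triangle x w y]

variable {H : Type*} [NormedAddCommGroup H] [InnerProductSpace ℝ H] [CompleteSpace H]

lemma crp_core {E : Type*} [NormedAddCommGroup E] [NormedSpace ℝ E]
    [CompleteSpace E] (hE : HasCRP E) (J : H →L[ℝ] Lp ℝ 2 μ) (T : H →L[ℝ] E) (C : ℝ)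
    (hJ : ∀ h, ‖J h‖ ≤ ‖h‖) (hC : 0 ≤ C)
    (hT : ∀ h, ‖T h‖ ≤ C * inner ℝ (crpInd μ Set.univ) |J h|)
    (hpos : ∀ g, 0 ≤ g → 0 ≤ J (J.adjoint g))
    (hone : J (J.adjoint (crpInd μ Set.univ)) = crpInd μ Set.univ) :
    TotallyBounded (T '' {h | ‖h‖ ≤ 1 ∧ -crpInd μ Set.univ ≤ J h ∧ J h ≤ crpInd μ Set.univ}) := by
  have hTJ : ∀ h, ‖T h‖ ≤ C * ‖J h‖ := by
    intro h
    refine (hT h).trans ?_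
    gcongr
    refine (real_inner_le_norm _ _).trans ?_
    rw [crpInd_univ_norm, one_mul, norm_abs_eq_norm]
  have hS : ∀ s, ‖(T.comp J.adjoint) (crpInd μ s)‖ ≤ C * μ.real s := by
    intro s
    by_cases hs : MeasurableSet s
    · refine (hT (J.adjoint (crpInd μ s))).trans ?_
      rw [abs_of_nonneg (hpos _ (crpInd_nonneg μ s)), ← ContinuousLinearMap.adjoint_inner_left,
        ← ContinuousLinearMap.adjoint_inner_left, ContinuousLinearMap.adjoint_adjoint, hone,
        crpInd_inner_univ μ hs]
    · rw [crpInd, dif_neg hs, map_zero, norm_zero]; positivity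
  obtain ⟨W, hW, hWS⟩ := crp_totallyBounded_sym μ hE (T.comp J.adjoint) C hS
  set o := crpInd μ Set.univ with ho
  let D : H → H := fun y => y - J.adjoint (J y)
  have hmono : ∀ g g', g ≤ g' → J (J.adjoint g) ≤ J (J.adjoint g') := by
    intro g g' hg
    have := hpos _ (sub_nonneg.2 hg)
    rwa [map_sub, map_sub, sub_nonneg] at this
  have hJD : ∀ y, J (D y) = J y - J (J.adjoint (J y)) := fun y => map_sub _ _ _
  have hbd : ∀ h, -o ≤ J h → J h ≤ o → ∀ n : ℕ,
      -((2:ℝ) ^ n • o) ≤ J (D^[n] h) ∧ J (D^[n] h) ≤ (2:ℝ) ^ n • o := by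
    intro h h1 h2 n
    induction n with
    | zero => simpa using ⟨h1, h2⟩
    | succ n ih =>
      obtain ⟨i1, i2⟩ := ih
      rw [Function.iterate_succ_apply', hJD]
      have j1 := hmono _ _ i1
      have j2 := hmono _ _ i2
      simp only [map_neg, map_smul, hone] at j1 j2
      have e : (2:ℝ) ^ (n+1) • o = (2:ℝ) ^ n • o + (2:ℝ) ^ n • o := by
        rw [pow_succ]; module
      rw [e]
      constructor
      · rw [neg_add, ← sub_eq_add_neg]
        exact sub_le_sub i1 j2
      · have := sub_le_sub i2 j1
        rwa [sub_neg_eq_add] at this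
  have hadj : ∀ v, ‖J (J.adjoint v)‖ ≤ ‖J.adjoint v‖ := fun v => hJ _
  have hDn : ∀ y, ‖J (D y)‖ ^ 2 ≤ ‖J y‖ ^ 2 := by
    intro y
    rw [hJD, norm_sub_sq_real]
    have : inner ℝ (J y) (J (J.adjoint (J y))) = ‖J.adjoint (J y)‖ ^ 2 := by
      rw [← ContinuousLinearMap.adjoint_inner_left, real_inner_self_eq_norm_sq]
    rw [this]
    have := pow_le_pow_left₀ (norm_nonneg _) (hadj (J y)) 2
    nlinarith [sq_nonneg ‖J.adjoint (J y)‖]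
  have hDn2 : ∀ y, ‖D y‖ ^ 2 ≤ ‖y‖ ^ 2 - ‖J y‖ ^ 2 := by
    intro y
    have h1 : ‖D y‖ ^ 2 = ‖y‖ ^ 2 - 2 * inner ℝ y (J.adjoint (J y)) + ‖J.adjoint (J y)‖ ^ 2 :=
      norm_sub_sq_real _ _
    rw [ContinuousLinearMap.adjoint_inner_right, real_inner_self_eq_norm_sq] at h1
    have h2 : ‖J.adjoint (J y)‖ ≤ ‖J y‖ := by
      refine (J.adjoint.le_opNorm _).trans ?_
      rw [LinearIsometryEquiv.norm_map]
      have : ‖J‖ ≤ 1 := J.opNorm_le_bound zero_le_one (by simpa using hJ)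
      exact mul_le_of_le_one_left (norm_nonneg _) this
    have := pow_le_pow_left₀ (norm_nonneg _) h2 2
    linarith
  have hdec : ∀ h, ∀ n : ℕ, n * ‖J (D^[n] h)‖ ^ 2 + ‖D^[n] h‖ ^ 2 ≤ ‖h‖ ^ 2 := by
    intro h n
    induction n with
    | zero => simp
    | succ n ih =>
      rw [Function.iterate_succ_apply']
      have h1 := hDn (D^[n] h)
      have h2 := hDn2 (D^[n] h)
      push_cast
      nlinarith [(Nat.cast_nonneg n : (0:ℝ) ≤ n)]
  have hWn : ∀ n : ℕ, ∃ V : Set E, IsCompact V ∧ ∀ h, -o ≤ J h → J h ≤ o →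
      T h - T (D^[n] h) ∈ V := by
    intro n
    induction n with
    | zero => exact ⟨{0}, isCompact_singleton, by simp⟩
    | succ n ih =>
      obtain ⟨V, hV, hVm⟩ := ih
      refine ⟨V + (2:ℝ) ^ n • W, hV.add (hW.smul _), fun h h1 h2 => ?_⟩
      have e : T h - T (D^[n+1] h) = (T h - T (D^[n] h)) + T (J.adjoint (J (D^[n] h))) := by
        rw [Function.iterate_succ_apply']
        simp only [D, map_sub]
        abel
      rw [e]
      exact Set.add_mem_add (hVm h h1 h2)
        (hWS _ (by positivity) _ (hbd h h1 h2 n).1 (hbd h h1 h2 n).2)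
  apply crp_totallyBounded_of_approx
  intro ε hε
  obtain ⟨n, hn⟩ := exists_nat_gt (C ^ 2 / ε ^ 2)
  rw [div_lt_iff₀ (by positivity)] at hn
  obtain ⟨V, hV, hVm⟩ := hWn n
  refine ⟨V, hV, ?_⟩
  rintro _ ⟨h, ⟨h0, h1, h2⟩, rfl⟩
  refine ⟨_, hVm h h1 h2, ?_⟩
  rw [_root_.sub_sub_cancel]
  have k1 := hdec h n
  have k2 := hTJ (D^[n] h)
  have k3 : ‖h‖ ^ 2 ≤ 1 := by nlinarith [norm_nonneg h]
  by_contra hcon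
  push Not at hcon
  have k4 : ε ^ 2 ≤ C ^ 2 * ‖J (D^[n] h)‖ ^ 2 := by
    rw [← mul_pow]; exact pow_le_pow_left₀ hε.le (hcon.trans k2) 2
  have k5 : (n:ℝ) * ‖J (D^[n] h)‖ ^ 2 ≤ 1 := by nlinarith [sq_nonneg ‖D^[n] h‖]
  have : n * ε ^ 2 ≤ C ^ 2 := by
    calc n * ε ^ 2 ≤ n * (C ^ 2 * ‖J (D^[n] h)‖ ^ 2) := by gcongr
      _ = C ^ 2 * (n * ‖J (D^[n] h)‖ ^ 2) := by ring
      _ ≤ C ^ 2 * 1 := by gcongr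
      _ = C ^ 2 := mul_one _
  linarith

end PartThree

section PartFour

open scoped CompactlySupported

variable {K : Type*} [TopologicalSpace K] [CompactSpace K] [T2Space K] [MeasurableSpace K]
  [BorelSpace K]

lemma crp_rmk (L : C(K, ℝ) →L[ℝ] ℝ) (hL : ∀ g : C(K, ℝ), (∀ x, 0 ≤ g x) → 0 ≤ L g)
    (h1 : L 1 = 1) : ∃ μ : Measure K, IsProbabilityMeasure μ ∧
      ∀ g : C(K, ℝ), ∫ x, g x ∂μ = L g := by
  let Λ0 : C_c(K, ℝ) →ₗ[ℝ] ℝ :=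
    { toFun := fun g => L g.toContinuousMap
      map_add' := fun g h => by
        have : (g + h).toContinuousMap = g.toContinuousMap + h.toContinuousMap := by ext; rfl
        rw [this, map_add]
      map_smul' := fun r g => by
        have : (r • g).toContinuousMap = r • g.toContinuousMap := by ext; rfl
        rw [this, map_smul]; rfl }
  let Λ : C_c(K, ℝ) →ₚ[ℝ] ℝ := PositiveLinearMap.mk₀ Λ0 (fun g hg => hL _ (fun x => hg x))
  have key : ∀ g : C(K, ℝ), ∫ x, g x ∂(RealRMK.rieszMeasure Λ) = L g := by
    intro g
    exact RealRMK.integral_rieszMeasure Λ (CompactlySupportedContinuousMap.continuousMapEquiv g)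
  refine ⟨RealRMK.rieszMeasure Λ, ⟨?_⟩, key⟩
  have := key 1
  rw [h1] at this
  simp only [ContinuousMap.one_apply, integral_const, smul_eq_mul, mul_one] at this
  rw [measureReal_def] at this
  rw [← ENNReal.ofReal_toReal (measure_ne_top (RealRMK.rieszMeasure Λ) Set.univ), this]
  simp

lemma crp_pietsch [Nonempty K] (G : Set C(K, ℝ)) (h0 : 0 ∈ G)
    (hG : ∀ b ∈ convexHull ℝ G, ∃ x, b x ≤ 0) :
    ∃ μ : Measure K, IsProbabilityMeasure μ ∧ ∀ b ∈ G, ∫ x, b x ∂μ ≤ 0 := by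
  let P : Set C(K, ℝ) := {g | ∀ x, 0 < g x}
  have hPo : IsOpen P := by
    have := ContinuousMap.isOpen_setOfPred_mapsTo (X := K) (Y := ℝ) isCompact_univ
      (isOpen_Ioi (a := (0:ℝ)))
    convert this using 1
    ext g
    simp [P, Set.MapsTo]
  have hPc : Convex ℝ P := by
    intro g hg h hh a b ha hb hab x
    simp only [ContinuousMap.add_apply, ContinuousMap.smul_apply, smul_eq_mul]
    have h1 := hg x
    have h2 := hh x
    rcases eq_or_lt_of_le ha with h | h
    · subst h; simp at hab; subst hab; simpa using h2
    · have := mul_pos h h1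
      have := mul_nonneg hb h2.le
      linarith
  have hdisj : Disjoint P (convexHull ℝ G) := by
    rw [Set.disjoint_left]
    intro g hg hgG
    obtain ⟨x, hx⟩ := hG g hgG
    exact absurd (hg x) (not_lt.2 hx)
  obtain ⟨f, u, hf1, hf2⟩ := geometric_hahn_banach_open hPc hPo (convex_convexHull ℝ G) hdisj
  have hu : u ≤ 0 := by
    have := hf2 0 (subset_convexHull ℝ _ h0)
    simpa using this
  have h1P : (1 : C(K, ℝ)) ∈ P := fun x => by simp
  have hneg : ∀ g ∈ P, f g < 0 := fun g hg => (hf1 g hg).trans_le hu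
  have hu0 : 0 ≤ u := by
    by_contra hcon
    push Not at hcon
    have h3 := hneg 1 h1P
    set t := u / (2 * f 1) with ht
    have htpos : 0 < t := div_pos_of_neg_of_neg hcon (by linarith)
    have := hf1 (t • 1) (fun x => by simpa using htpos)
    rw [map_smul, smul_eq_mul, ht] at this
    have e : u / (2 * f 1) * f 1 = u / 2 := by
      have := h3.ne
      field_simp
    rw [e] at this
    linarith
  have hnn : ∀ g : C(K, ℝ), (∀ x, 0 ≤ g x) → f g ≤ 0 := by
    intro g hg
    refine le_of_forall_pos_le_add fun ε hε => ?_
    have h3 := hneg 1 h1P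
    have hp : 0 < ε / (-f 1) := div_pos hε (by linarith)
    have := hneg (g + (ε / (-f 1)) • 1) (fun x => by
      have := hg x
      simp only [ContinuousMap.add_apply, ContinuousMap.smul_apply, ContinuousMap.one_apply,
        smul_eq_mul, mul_one]
      linarith)
    rw [map_add, map_smul, smul_eq_mul] at this
    have e : ε / (-f 1) * f 1 = -ε := by
      have := h3.ne
      field_simp
    rw [e] at this
    linarith
  have h3 := hneg 1 h1P
  obtain ⟨μ, hμ, hInteg⟩ := crp_rmk ((f 1)⁻¹ • f) (fun g hg => by
    have := hnn g hg
    simp only [smul_apply, smul_eq_mul]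
    exact mul_nonneg_of_nonpos_of_nonpos (inv_nonpos.2 h3.le) this) (by
    simp only [smul_apply, smul_eq_mul]
    exact inv_mul_cancel₀ h3.ne)
  refine ⟨μ, hμ, fun b hb => ?_⟩
  rw [hInteg]
  have := hf2 b (subset_convexHull ℝ _ hb)
  simp only [smul_apply, smul_eq_mul]
  exact mul_nonpos_of_nonpos_of_nonneg (inv_nonpos.2 h3.le) (by linarith)

end PartFour

section PartFive

/-- A pre-inner product produces a Hilbert space. -/
lemma crp_preHilbert {V : Type} [AddCommGroup V] [Module ℝ V] (c : PreInnerProductSpace.Core ℝ V) :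
    ∃ (H : Type) (_ : NormedAddCommGroup H) (_ : InnerProductSpace ℝ H) (_ : CompleteSpace H)
      (ι : V →ₗ[ℝ] H), DenseRange ι ∧ ∀ x y, inner ℝ (ι x) (ι y) = c.inner x y := by
  letI : SeminormedAddCommGroup V := InnerProductSpace.Core.toSeminormedAddCommGroup (c := c)
  letI : InnerProductSpace ℝ V := InnerProductSpace.ofCore c
  refine ⟨UniformSpace.Completion V, inferInstance, inferInstance, inferInstance,
    (UniformSpace.Completion.toComplL (𝕜 := ℝ) (E := V)).toLinearMap, ?_, ?_⟩
  · exact UniformSpace.Completion.denseRange_coe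
  · intro x y
    exact UniformSpace.Completion.inner_coe x y

end PartFive

section PartSix

variable {A : Type} [CStarAlgebra A]

lemma crp_norm_add [Nontrivial A] (a : selfAdjoint A) (h : ‖a‖ ∈ spectrum ℝ (a : A)) :
    2 * ‖a‖ ≤ ‖a + ‖a‖ • (1 : selfAdjoint A)‖ := by
  have h1 : ‖a‖ + ‖a‖ ∈ spectrum ℝ ((algebraMap ℝ A ‖a‖) + (a : A)) :=
    spectrum.add_mem_add_iff.2 h
  have h2 := spectrum.norm_le_norm_of_mem h1
  have e : ((a + ‖a‖ • (1 : selfAdjoint A) : selfAdjoint A) : A) =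
      (algebraMap ℝ A ‖a‖) + (a : A) := by
    rw [Algebra.algebraMap_eq_smul_one, add_comm]
    simp
  change _ ≤ ‖((a + ‖a‖ • (1 : selfAdjoint A) : selfAdjoint A) : A)‖
  rw [e]
  refine le_trans ?_ h2
  rw [Real.norm_eq_abs, two_mul]
  exact le_abs_self _

lemma crp_one_norm [Nontrivial A] : ‖(1 : selfAdjoint A)‖ = 1 := by
  change ‖((1 : selfAdjoint A) : A)‖ = 1
  simp

lemma crp_exists_state [Nontrivial A] (a : selfAdjoint A) (ha : a ≠ 0)
    (h : ‖a‖ ∈ spectrum ℝ (a : A)) :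
    ∃ φ : StrongDual ℝ (selfAdjoint A), ‖φ‖ ≤ 1 ∧ φ 1 = 1 ∧ φ a = ‖a‖ := by
  have h1 := crp_norm_add a h
  have hpos : 0 < ‖a‖ := norm_pos_iff.2 ha
  obtain ⟨g, hg, hga⟩ := exists_dual_vector ℝ (a + ‖a‖ • (1 : selfAdjoint A)) (by linarith)
  have k1 : g a ≤ ‖a‖ := by
    have := g.le_opNorm a
    rw [hg, one_mul] at this
    exact (le_abs_self _).trans this
  have k2 : g 1 ≤ 1 := by
    have := g.le_opNorm 1
    rw [hg, one_mul, crp_one_norm] at this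
    exact (le_abs_self _).trans this
  rw [map_add, map_smul, smul_eq_mul] at hga
  simp only [RCLike.ofReal_real_eq_id, id] at hga
  have k3 : ‖a‖ * g 1 ≤ ‖a‖ * 1 := by gcongr
  refine ⟨g, hg.le, ?_, by linarith⟩
  have k4 : ‖a‖ * g 1 = ‖a‖ * 1 := by linarith
  exact mul_left_cancel₀ hpos.ne' k4

lemma crp_exists_state_abs [Nontrivial A] (a : selfAdjoint A) :
    ∃ φ : StrongDual ℝ (selfAdjoint A), ‖φ‖ ≤ 1 ∧ φ 1 = 1 ∧ |φ a| = ‖a‖ := by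
  have hnz : ∀ a : selfAdjoint A, a ≠ 0 →
      ∃ φ : StrongDual ℝ (selfAdjoint A), ‖φ‖ ≤ 1 ∧ φ 1 = 1 ∧ |φ a| = ‖a‖ := by
    intro a ha
    rcases CStarAlgebra.norm_or_neg_norm_mem_spectrum (a := (a : A)) a.2 with h | h
    · obtain ⟨φ, h1, h2, h3⟩ := crp_exists_state a ha h
      exact ⟨φ, h1, h2, by rw [h3, abs_norm]⟩
    · have h' : ‖-a‖ ∈ spectrum ℝ ((-a : selfAdjoint A) : A) := by
        rw [norm_neg]
        have : ((-a : selfAdjoint A) : A) = -(a : A) := rfl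
        rw [this, ← spectrum.neg_eq, Set.mem_neg]
        exact h
      obtain ⟨φ, h1, h2, h3⟩ := crp_exists_state (-a) (neg_ne_zero.2 ha) h'
      rw [map_neg, norm_neg] at h3
      refine ⟨φ, h1, h2, ?_⟩
      rw [← abs_neg, h3, abs_norm]
  by_cases ha : a = 0
  · obtain ⟨φ, h1, h2, -⟩ := hnz 1 (norm_pos_iff.1 (by rw [crp_one_norm]; exact one_pos))
    exact ⟨φ, h1, h2, by simp [ha]⟩
  · exact hnz a ha

lemma crp_state_nonneg [PartialOrder A] [StarOrderedRing A]
    (φ : StrongDual ℝ (selfAdjoint A)) (h1 : ‖φ‖ ≤ 1) (h2 : φ 1 = 1)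
    (a : selfAdjoint A) (ha : 0 ≤ (a : A)) : 0 ≤ φ a := by
  have k1 : (a : A) ≤ algebraMap ℝ A ‖(a : A)‖ := IsSelfAdjoint.le_algebraMap_norm_self a.2
  have k2 : ‖algebraMap ℝ A ‖(a : A)‖ - (a : A)‖ ≤ ‖(a : A)‖ := by
    rw [CStarAlgebra.norm_le_iff_le_algebraMap _ (norm_nonneg _) (sub_nonneg.2 k1)]
    exact sub_le_self _ ha
  have k3 : ‖‖a‖ • (1 : selfAdjoint A) - a‖ ≤ ‖a‖ := by
    refine le_trans (le_of_eq ?_) k2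
    rw [Algebra.algebraMap_eq_smul_one]
    rfl
  have k4 := φ.le_of_opNorm_le h1 (‖a‖ • (1 : selfAdjoint A) - a)
  rw [map_sub, map_smul, h2, smul_eq_mul, mul_one, Real.norm_eq_abs] at k4
  have := le_abs_self (‖a‖ - φ a)
  linarith

lemma crp_states [PartialOrder A] [StarOrderedRing A] [Nontrivial A] :
    ∃ (K : Type) (_ : TopologicalSpace K) (_ : CompactSpace K) (_ : T2Space K) (_ : Nonempty K)
      (ev : selfAdjoint A →ₗ[ℝ] C(K, ℝ)), ev 1 = 1 ∧ (∀ a : selfAdjoint A, 0 ≤ (a : A) → ∀ ψ, 0 ≤ ev a ψ) ∧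
        (∀ a ψ, |ev a ψ| ≤ ‖a‖) ∧ (∀ a, ∃ ψ, |ev a ψ| = ‖a‖) := by
  let Ks : Set (WeakDual ℝ (selfAdjoint A)) :=
    (WeakDual.toStrongDual ⁻¹' Metric.closedBall 0 1) ∩ {φ | φ 1 = 1}
  have hK : IsCompact Ks := (WeakDual.isCompact_closedBall 0 1).inter_right
    (isClosed_eq (WeakDual.eval_continuous _) continuous_const)
  have hb : ∀ φ : StrongDual ℝ (selfAdjoint A),
      φ ∈ Metric.closedBall (0 : StrongDual ℝ (selfAdjoint A)) 1 ↔ ‖φ‖ ≤ 1 := by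
    intro φ
    exact @mem_closedBall_zero_iff (StrongDual ℝ (selfAdjoint A)) _ φ 1
  have hmem : ∀ φ : StrongDual ℝ (selfAdjoint A), ‖φ‖ ≤ 1 → φ 1 = 1 →
      WeakDual.toStrongDual.symm φ ∈ Ks := by
    intro φ h1 h2
    refine ⟨?_, h2⟩
    exact (hb φ).2 h1
  have hn : ∀ ψ : Ks, ‖WeakDual.toStrongDual ψ.1‖ ≤ 1 := by
    intro ψ
    exact (hb _).1 ψ.2.1
  let ev : selfAdjoint A →ₗ[ℝ] C(Ks, ℝ) :=
    { toFun := fun a => ⟨fun ψ => ψ.1 a, (WeakDual.eval_continuous a).comp continuous_subtype_val⟩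
      map_add' := fun a b => by ext ψ; exact map_add ψ.1 a b
      map_smul' := fun r a => by ext ψ; exact map_smul ψ.1 r a }
  have hev : ∀ a ψ, ev a ψ = WeakDual.toStrongDual ψ.1 a := fun a ψ => rfl
  have hex : ∀ a, ∃ ψ, |ev a ψ| = ‖a‖ := by
    intro a
    obtain ⟨φ, h1, h2, h3⟩ := crp_exists_state_abs a
    exact ⟨⟨_, hmem φ h1 h2⟩, h3⟩
  obtain ⟨ψ0, -⟩ := hex 1
  refine ⟨Ks, inferInstance, isCompact_iff_compactSpace.1 hK, inferInstance, ⟨ψ0⟩, ev, ?_, ?_, ?_,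
    hex⟩
  · ext ψ; exact ψ.2.2
  · intro a ha ψ
    rw [hev]
    exact crp_state_nonneg _ (hn ψ) ψ.2.2 a ha
  · intro a ψ
    have := (WeakDual.toStrongDual ψ.1).le_of_opNorm_le (hn ψ) a
    rw [one_mul, Real.norm_eq_abs] at this
    exact this

end PartSix

section PartSeven

variable {A : Type} [CStarAlgebra A] {K : Type} [TopologicalSpace K] [CompactSpace K] [T2Space K]
  [Nonempty K] (ev : selfAdjoint A →ₗ[ℝ] C(K, ℝ))

lemma crp_sum_abs_le (hex : ∀ a, ∃ ψ, |ev a ψ| = ‖a‖)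
    (ℓ : selfAdjoint A → ℝ) (hadd : ∀ x y, ℓ (x + y) = ℓ x + ℓ y)
    (hsmul : ∀ (r : ℝ) x, ℓ (r • x) = r * ℓ x) (hℓ : ∀ y, |ℓ y| ≤ ‖y‖)
    {n : ℕ} (x : Fin n → selfAdjoint A) (M : ℝ) (hM : ∀ ψ, ∑ i, |ev (x i) ψ| ≤ M) :
    ∑ i, |ℓ (x i)| ≤ M := by
  let L : selfAdjoint A →ₗ[ℝ] ℝ := { toFun := ℓ, map_add' := hadd, map_smul' := hsmul }
  let s : Fin n → ℝ := fun i => if 0 ≤ ℓ (x i) then 1 else -1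
  have hs : ∀ i, |s i| = 1 := by
    intro i
    simp only [s]
    split_ifs <;> simp
  have hs2 : ∀ i, |ℓ (x i)| = s i * ℓ (x i) := by
    intro i
    simp only [s]
    split_ifs with h
    · rw [abs_of_nonneg h, one_mul]
    · push Not at h; rw [abs_of_neg h]; ring
  have e : ∑ i, |ℓ (x i)| = L (∑ i, s i • x i) := by
    rw [map_sum]
    refine Finset.sum_congr rfl fun i _ => ?_
    rw [hs2, map_smul, smul_eq_mul]; rfl
  rw [e]
  obtain ⟨ψ, hψ⟩ := hex (∑ i, s i • x i)
  calc L (∑ i, s i • x i) ≤ |L (∑ i, s i • x i)| := le_abs_self _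
    _ ≤ ‖∑ i, s i • x i‖ := hℓ _
    _ = |ev (∑ i, s i • x i) ψ| := hψ.symm
    _ = |∑ i, s i * ev (x i) ψ| := by
      rw [map_sum, ContinuousMap.sum_apply]
      simp
    _ ≤ ∑ i, |s i * ev (x i) ψ| := Finset.abs_sum_le_sum_abs _ _
    _ = ∑ i, |ev (x i) ψ| := by simp [abs_mul, hs]
    _ ≤ M := hM ψ

lemma crp_summing (hex : ∀ a, ∃ ψ, |ev a ψ| = ‖a‖)
    {E : Type*} [NormedAddCommGroup E] [NormedSpace ℂ E] (T : A →L[ℂ] E)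
    (hT : OneSumming T) : ∃ C : ℝ, 0 ≤ C ∧ ∀ (n : ℕ) (x : Fin n → selfAdjoint A), ∃ ψ,
      ∑ i, ‖T (x i)‖ ≤ C * ∑ i, |ev (x i) ψ| := by
  obtain ⟨C, hC, hTC⟩ := hT
  refine ⟨2 * C, by positivity, fun n x => ?_⟩
  obtain ⟨ψ, -, hψ⟩ := isCompact_univ.exists_isMaxOn (Set.univ_nonempty (α := K))
    (f := fun ψ => ∑ i, |ev (x i) ψ|)
    (continuous_finsetSum _ fun i _ => (ev (x i)).continuous.abs).continuousOn
  refine ⟨ψ, (hTC n (fun i => x i)).trans ?_⟩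
  have hM : ∀ ψ', ∑ i, |ev (x i) ψ'| ≤ ∑ i, |ev (x i) ψ| := fun ψ' => hψ (Set.mem_univ ψ')
  have : sSup {r : ℝ | ∃ φ : StrongDual ℂ A, ‖φ‖ ≤ 1 ∧ r = ∑ i, ‖φ (x i)‖} ≤
      2 * ∑ i, |ev (x i) ψ| := by
    refine Real.sSup_le ?_ (mul_nonneg zero_le_two (Finset.sum_nonneg fun i _ => abs_nonneg _))
    rintro r ⟨φ, hφ, rfl⟩
    have hφn : ∀ y : selfAdjoint A, ‖φ y‖ ≤ ‖y‖ := fun y => by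
      have := φ.le_of_opNorm_le hφ (y : A)
      rwa [one_mul] at this
    have h1 := crp_sum_abs_le ev hex (fun y => (φ y).re) (fun x y => by simp)
      (fun r y => by simp)
      (fun y => (Complex.abs_re_le_norm _).trans (hφn y)) x _ hM
    have h2 := crp_sum_abs_le ev hex (fun y => (φ y).im) (fun x y => by simp)
      (fun r y => by simp)
      (fun y => (Complex.abs_im_le_norm _).trans (hφn y)) x _ hM
    calc ∑ i, ‖φ (x i)‖ ≤ ∑ i, (|(φ (x i)).re| + |(φ (x i)).im|) :=
          Finset.sum_le_sum fun i _ => Complex.norm_le_abs_re_add_abs_im _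
      _ ≤ 2 * ∑ i, |ev (x i) ψ| := by rw [Finset.sum_add_distrib]; linarith
  calc C * _ ≤ C * (2 * ∑ i, |ev (x i) ψ|) := by gcongr
    _ = 2 * C * ∑ i, |ev (x i) ψ| := by ring

lemma crp_pietsch_states (hex : ∀ a, ∃ ψ, |ev a ψ| = ‖a‖)
    [MeasurableSpace K] [BorelSpace K]
    {E : Type*} [NormedAddCommGroup E] [NormedSpace ℂ E] (T : A →L[ℂ] E)
    (hT : OneSumming T) : ∃ C : ℝ, 0 ≤ C ∧ ∃ μ : Measure K, IsProbabilityMeasure μ ∧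
      ∀ x : selfAdjoint A, ‖T x‖ ≤ C * ∫ ψ, |ev x ψ| ∂μ := by
  obtain ⟨C, hC, hTC⟩ := crp_summing ev hex T hT
  let b : selfAdjoint A → C(K, ℝ) := fun x => ‖T x‖ • 1 - C • |ev x|
  have hb : ∀ x ψ, b x ψ = ‖T x‖ - C * |ev x ψ| := by
    intro x ψ
    simp [b]
  obtain ⟨μ, hμ, h⟩ := crp_pietsch (Set.range b) ⟨0, by ext ψ; simp [hb]⟩ (by
    intro g hg
    rw [mem_convexHull_iff_exists_fintype] at hg
    obtain ⟨ι, _, w, z, hw, -, hz, rfl⟩ := hg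
    choose x hx using hz
    let e := Fintype.equivFin ι
    obtain ⟨ψ, hψ⟩ := hTC _ (fun j => w (e.symm j) • x (e.symm j))
    refine ⟨ψ, ?_⟩
    rw [e.symm.sum_comp (fun i => ‖T ((w i • x i : selfAdjoint A) : A)‖),
      e.symm.sum_comp (fun i => |ev (w i • x i) ψ|)] at hψ
    have k1 : ∀ i, ‖T ((w i • x i : selfAdjoint A) : A)‖ = w i * ‖T (x i)‖ := by
      intro i
      have : ((w i • x i : selfAdjoint A) : A) = (w i : ℂ) • (x i : A) := by simp
      rw [this, map_smul, norm_smul, Complex.norm_real, Real.norm_of_nonneg (hw i)]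
    have k2 : ∀ i, |ev (w i • x i) ψ| = w i * |ev (x i) ψ| := by
      intro i
      rw [map_smul, ContinuousMap.smul_apply, smul_eq_mul, abs_mul, abs_of_nonneg (hw i)]
    simp only [k1, k2] at hψ
    rw [ContinuousMap.sum_apply]
    simp only [ContinuousMap.smul_apply, smul_eq_mul, ← hx, hb, mul_sub, Finset.sum_sub_distrib]
    have : ∑ i, w i * (C * |ev (x i) ψ|) = C * ∑ i, w i * |ev (x i) ψ| := by
      rw [Finset.mul_sum]; exact Finset.sum_congr rfl fun i _ => by ring
    linarith)
  refine ⟨C, hC, μ, hμ, fun x => ?_⟩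
  have h1 := h _ ⟨x, rfl⟩
  simp only [hb] at h1
  have hi : Integrable (fun ψ => |ev x ψ|) μ :=
    (ev x).continuous.abs.integrable_of_hasCompactSupport (HasCompactSupport.of_compactSpace _)
  rw [integral_sub (integrable_const _) (hi.const_mul C), integral_const_mul] at h1
  simp at h1
  exact h1

end PartSeven

section PartEight

variable {A : Type} [CStarAlgebra A] [PartialOrder A] [StarOrderedRing A]
  {K : Type} [TopologicalSpace K] [CompactSpace K] [T2Space K]

/-- The symmetrised product on the self-adjoint part. -/
noncomputable def crpJ (x y : selfAdjoint A) : selfAdjoint A :=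
  selfAdjointPart ℝ ((x : A) * (y : A))

lemma crpJ_comm (x y : selfAdjoint A) : crpJ x y = crpJ y x := by
  apply Subtype.ext
  simp only [crpJ, selfAdjointPart_apply_coe, star_mul, selfAdjoint.star_val_eq]
  rw [add_comm]

lemma crpJ_of_commute (x y z : selfAdjoint A) (h : (x : A) * y = z) : crpJ x y = z := by
  apply Subtype.ext
  rw [crpJ, h, selfAdjointPart_apply_coe, selfAdjoint.star_val_eq, ← two_smul ℝ, smul_smul]
  simp

lemma crpJ_self (x : selfAdjoint A) : ((crpJ x x : selfAdjoint A) : A) = x * x := by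
  rw [crpJ, selfAdjointPart_apply_coe, star_mul, selfAdjoint.star_val_eq, ← two_smul ℝ, smul_smul]
  simp

lemma crpJ_self_nonneg (x : selfAdjoint A) : 0 ≤ ((crpJ x x : selfAdjoint A) : A) := by
  rw [crpJ_self]
  have := star_mul_self_nonneg (x : A)
  rwa [selfAdjoint.star_val_eq] at this

lemma crpJ_add_left (x y z : selfAdjoint A) : crpJ (x + y) z = crpJ x z + crpJ y z := by
  simp [crpJ, add_mul]

lemma crpJ_smul_left (r : ℝ) (x z : selfAdjoint A) : crpJ (r • x) z = r • crpJ x z := by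
  simp [crpJ]

lemma crp_ev_sq (ev : selfAdjoint A →ₗ[ℝ] C(K, ℝ)) (h1 : ev 1 = 1)
    (hev0 : ∀ a : selfAdjoint A, 0 ≤ (a : A) → ∀ ψ, 0 ≤ ev a ψ) (x : selfAdjoint A) (ψ : K) :
    (ev x ψ) ^ 2 ≤ ev (crpJ x x) ψ := by
  set r := ev x ψ with hr
  have e : crpJ (x - r • 1) (x - r • 1) = crpJ x x - (2 * r) • x + (r ^ 2) • 1 := by
    apply Subtype.ext
    rw [crpJ_self]
    simp only [AddSubgroup.coe_add, AddSubgroup.coe_sub, crpJ_self, selfAdjoint.val_smul,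
      selfAdjoint.val_one]
    simp only [sub_mul, mul_sub, smul_mul_assoc, one_mul, mul_smul_comm, mul_one, smul_sub,
      smul_smul]
    module
  have h := hev0 _ (crpJ_self_nonneg (x - r • 1)) ψ
  rw [e, map_add, map_sub, map_smul, map_smul, h1] at h
  simp only [ContinuousMap.add_apply, ContinuousMap.sub_apply, ContinuousMap.smul_apply,
    ContinuousMap.one_apply, smul_eq_mul, ← hr] at h
  nlinarith

/-- The pre-inner product associated with an averaged state. -/
noncomputable def crpCore (f : selfAdjoint A →ₗ[ℝ] ℝ)
    (hf : ∀ a : selfAdjoint A, 0 ≤ (a : A) → 0 ≤ f a) :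
    PreInnerProductSpace.Core ℝ (selfAdjoint A) where
  inner x y := f (crpJ x y)
  conj_inner_symm x y := by
    change f (crpJ y x) = f (crpJ x y)
    rw [crpJ_comm]
  re_inner_nonneg x := hf _ (crpJ_self_nonneg x)
  add_left x y z := by
    change f (crpJ (x + y) z) = f (crpJ x z) + f (crpJ y z)
    rw [crpJ_add_left, map_add]
  smul_left x y r := by
    change f (crpJ (r • x) y) = r * f (crpJ x y)
    rw [crpJ_smul_left, map_smul, smul_eq_mul]

/-- Decomposition into positive and negative parts. -/
lemma crp_decomp (x : selfAdjoint A) : ∃ p q : selfAdjoint A, 0 ≤ (p : A) ∧ 0 ≤ (q : A) ∧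
    p - q = x ∧ crpJ x q = - crpJ q q := by
  have hp : 0 ≤ (x : A)⁺ := CFC.posPart_nonneg _
  have hq : 0 ≤ (x : A)⁻ := CFC.negPart_nonneg _
  have h := CFC.posPart_sub_negPart (x : A) x.2
  refine ⟨⟨(x : A)⁺, IsSelfAdjoint.of_nonneg hp⟩, ⟨(x : A)⁻, IsSelfAdjoint.of_nonneg hq⟩, hp, hq,
    Subtype.ext h, ?_⟩
  apply crpJ_of_commute
  rw [AddSubgroup.coe_neg, crpJ_self]
  change (x : A) * (x : A)⁻ = -((x : A)⁻ * (x : A)⁻)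
  calc (x : A) * (x : A)⁻ = ((x : A)⁺ - (x : A)⁻) * (x : A)⁻ := by rw [h]
    _ = -((x : A)⁻ * (x : A)⁻) := by rw [sub_mul, CFC.posPart_mul_negPart, zero_sub]

end PartEight

section PartNine

open scoped InnerProduct

section toLp
variable {K : Type} [TopologicalSpace K] [CompactSpace K] [MeasurableSpace K] [BorelSpace K]
  (μ : Measure K) [IsProbabilityMeasure μ]

lemma crp_toLp_one : ContinuousMap.toLp 2 μ ℝ (1 : C(K, ℝ)) = crpInd μ Set.univ := by
  apply Lp.ext
  filter_upwards [ContinuousMap.coeFn_toLp (p := 2) (𝕜 := ℝ) μ (1 : C(K, ℝ)),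
    crpInd_univ_coe μ] with x h1 h2
  rw [h1, h2]; rfl

lemma crp_toLp_mono {g h : C(K, ℝ)} (hg : ∀ x, g x ≤ h x) :
    ContinuousMap.toLp 2 μ ℝ g ≤ ContinuousMap.toLp 2 μ ℝ h := by
  rw [← Lp.coeFn_le]
  filter_upwards [ContinuousMap.coeFn_toLp (p := 2) (𝕜 := ℝ) μ g,
    ContinuousMap.coeFn_toLp (p := 2) (𝕜 := ℝ) μ h] with x h1 h2
  rw [h1, h2]; exact hg x

lemma crp_toLp_norm_sq (g : C(K, ℝ)) :
    ‖ContinuousMap.toLp 2 μ ℝ g‖ ^ 2 = ∫ x, (g x) ^ 2 ∂μ := by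
  rw [← real_inner_self_eq_norm_sq, L2.inner_def]
  refine integral_congr_ae ?_
  filter_upwards [ContinuousMap.coeFn_toLp (p := 2) (𝕜 := ℝ) μ g] with x h1
  rw [h1]; simp [sq]

lemma crp_inner_one (g : Lp ℝ 2 μ) : inner ℝ (crpInd μ Set.univ) g = ∫ x, g x ∂μ := by
  rw [L2.inner_def]
  refine integral_congr_ae ?_
  filter_upwards [crpInd_univ_coe μ] with x h1
  rw [h1]; simp

lemma crp_inner_one_toLp (g : C(K, ℝ)) :
    inner ℝ (crpInd μ Set.univ) (ContinuousMap.toLp 2 μ ℝ g) = ∫ x, g x ∂μ := by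
  rw [crp_inner_one]
  refine integral_congr_ae ?_
  filter_upwards [ContinuousMap.coeFn_toLp (p := 2) (𝕜 := ℝ) μ g] with x h1
  rw [h1]

lemma crp_inner_one_abs_toLp (g : C(K, ℝ)) :
    inner ℝ (crpInd μ Set.univ) |ContinuousMap.toLp 2 μ ℝ g| = ∫ x, |g x| ∂μ := by
  rw [crp_inner_one]
  refine integral_congr_ae ?_
  filter_upwards [ContinuousMap.coeFn_toLp (p := 2) (𝕜 := ℝ) μ g,
    Lp.coeFn_abs (ContinuousMap.toLp 2 μ ℝ g)] with x h1 h2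
  rw [h2, h1]

lemma crp_inner_nonneg {g h : Lp ℝ 2 μ} (hg : 0 ≤ g) (hh : 0 ≤ h) : 0 ≤ inner ℝ g h := by
  rw [L2.inner_def]
  refine integral_nonneg_of_ae ?_
  filter_upwards [(Lp.coeFn_nonneg g).2 hg, (Lp.coeFn_nonneg h).2 hh] with x h1 h2
  have : inner ℝ (g x) (h x) = h x * g x := by simp
  rw [this]
  exact mul_nonneg h2 h1

lemma crp_integrable (g : C(K, ℝ)) : Integrable g μ :=
  g.continuous.integrable_of_hasCompactSupport (HasCompactSupport.of_compactSpace _)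

/-- Integration against a measure as a linear functional. -/
noncomputable def crpInt : C(K, ℝ) →ₗ[ℝ] ℝ where
  toFun g := ∫ x, g x ∂μ
  map_add' g h := integral_add (crp_integrable μ g) (crp_integrable μ h)
  map_smul' r g := integral_const_mul r g

end toLp

lemma crp_main {A : Type} [CStarAlgebra A] [PartialOrder A] [StarOrderedRing A] [Nontrivial A]
    {E : Type*} [NormedAddCommGroup E] [NormedSpace ℂ E] [CompleteSpace E] (hE : HasCRP E)
    (T : A →L[ℂ] E) (hT : OneSumming T) :
    TotallyBounded ((fun a : selfAdjoint A => T a) '' {a | ‖a‖ ≤ 1}) := by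
  obtain ⟨K, _, _, _, _, ev, hev1, hev0, hevn, hex⟩ := crp_states (A := A)
  letI : MeasurableSpace K := borel K
  haveI : BorelSpace K := ⟨rfl⟩
  obtain ⟨C, hC, μ, hμ, hTμ⟩ := crp_pietsch_states ev hex T hT
  let f : selfAdjoint A →ₗ[ℝ] ℝ := (crpInt μ).comp ev
  have hf : ∀ a, f a = ∫ ψ, ev a ψ ∂μ := fun a => rfl
  have hf0 : ∀ a : selfAdjoint A, 0 ≤ (a : A) → 0 ≤ f a := fun a ha => by
    rw [hf]; exact integral_nonneg (hev0 a ha)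
  obtain ⟨H, _, _, _, ι, hι, hin⟩ := crp_preHilbert (crpCore f hf0)
  have hin : ∀ x y, inner ℝ (ι x) (ι y) = f (crpJ x y) := hin
  have hιn : ∀ x, ‖ι x‖ ^ 2 = f (crpJ x x) := fun x => by
    rw [← real_inner_self_eq_norm_sq, hin]
  let J0 : selfAdjoint A →ₗ[ℝ] Lp ℝ 2 μ := (ContinuousMap.toLp 2 μ ℝ).toLinearMap.comp ev
  have hJ0 : ∀ x, J0 x = ContinuousMap.toLp 2 μ ℝ (ev x) := fun x => rfl
  have hJ0n : ∀ x, ‖J0 x‖ ≤ 1 * ‖ι x‖ := by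
    intro x
    rw [one_mul, ← sq_le_sq₀ (norm_nonneg _) (norm_nonneg _), hιn, hJ0, crp_toLp_norm_sq, hf]
    refine integral_mono ?_ (crp_integrable μ _) (fun ψ => crp_ev_sq ev hev1 hev0 x ψ)
    exact crp_integrable μ ((ev x) ^ 2)
  let T0 : selfAdjoint A →ₗ[ℝ] E :=
    { toFun := fun x => T x
      map_add' := fun x y => by simp
      map_smul' := fun r x => by
        have : ((r • x : selfAdjoint A) : A) = (r : ℂ) • (x : A) := by simp
        rw [this, map_smul]
        simp }
  have hT0 : ∀ x, ‖T0 x‖ ≤ C * inner ℝ (crpInd μ Set.univ) |J0 x| := by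
    intro x
    rw [hJ0, crp_inner_one_abs_toLp]
    exact hTμ x
  have hT0n : ∀ x, ‖T0 x‖ ≤ C * ‖ι x‖ := by
    intro x
    refine (hT0 x).trans ?_
    gcongr
    refine (real_inner_le_norm _ _).trans ?_
    rw [crpInd_univ_norm, one_mul, norm_abs_eq_norm]
    simpa using hJ0n x
  let J : H →L[ℝ] Lp ℝ 2 μ := J0.extendOfNorm ι
  let T1 : H →L[ℝ] E := T0.extendOfNorm ι
  have hJe : ∀ x, J (ι x) = J0 x := LinearMap.extendOfNorm_eq hι ⟨1, hJ0n⟩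
  have hT1e : ∀ x, T1 (ι x) = T0 x := LinearMap.extendOfNorm_eq hι ⟨C, hT0n⟩
  have hJn : ∀ h, ‖J h‖ ≤ ‖h‖ := fun h => by
    have := LinearMap.norm_extendOfNorm_apply_le hι 1 hJ0n h
    rwa [one_mul] at this
  have hT1 : ∀ h, ‖T1 h‖ ≤ C * inner ℝ (crpInd μ Set.univ) |J h| := by
    intro h
    refine hι.induction_on (p := fun h => ‖T1 h‖ ≤ C * inner ℝ (crpInd μ Set.univ) |J h|) h ?_ ?_
    · refine isClosed_le (by fun_prop) ?_
      have habs : Continuous fun h => |J h| := by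
        have : (fun h => |J h|) = fun h => J h ⊔ -J h := rfl
        rw [this]
        exact Continuous.sup J.continuous J.continuous.neg
      exact continuous_const.mul (continuous_const.inner habs)
    · intro x
      rw [hT1e, hJe]
      exact hT0 x
  have hadj1 : J.adjoint (crpInd μ Set.univ) = ι 1 := by
    refine ext_inner_right ℝ fun h => ?_
    refine hι.induction_on
      (p := fun h => inner ℝ (J.adjoint (crpInd μ Set.univ)) h = inner ℝ (ι 1) h) h ?_ ?_
    · exact isClosed_eq (by fun_prop) (by fun_prop)
    · intro x
      rw [ContinuousLinearMap.adjoint_inner_left, hJe, hin, hJ0, crp_inner_one_toLp,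
        crpJ_of_commute 1 x x (by simp), hf]
  have hone : J (J.adjoint (crpInd μ Set.univ)) = crpInd μ Set.univ := by
    rw [hadj1, hJe, hJ0, hev1, crp_toLp_one]
  have hJ0pos : ∀ q : selfAdjoint A, 0 ≤ (q : A) → 0 ≤ J0 q := by
    intro q hq
    rw [hJ0, ← map_zero (ContinuousMap.toLp 2 μ ℝ : C(K, ℝ) →L[ℝ] Lp ℝ 2 μ)]
    exact crp_toLp_mono μ (hev0 q hq)
  have hpos : ∀ g, 0 ≤ g → 0 ≤ J (J.adjoint g) := by
    intro g hg
    set z := J.adjoint g with hz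
    have hcl : IsClosed {h | 0 ≤ J h} := isClosed_le continuous_const J.continuous
    suffices hmem : z ∈ closure {h | 0 ≤ J h} by
      rw [hcl.closure_eq] at hmem
      exact hmem
    rw [Metric.mem_closure_iff]
    intro ε hε
    obtain ⟨x, hx⟩ := hι.exists_dist_lt z (half_pos hε)
    obtain ⟨p, q, hp, hq, hpq, hJq⟩ := crp_decomp x
    refine ⟨ι p, ?_, ?_⟩
    · change 0 ≤ J (ι p)
      rw [hJe]
      exact hJ0pos p hp
    · rw [dist_eq_norm] at hx ⊢
      have k1 : inner ℝ (ι x) (ι q) = - ‖ι q‖ ^ 2 := by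
        rw [hin, hJq, map_neg, hιn]
      have k2 : 0 ≤ inner ℝ z (ι q) := by
        rw [hz, ContinuousLinearMap.adjoint_inner_left, hJe]
        exact crp_inner_nonneg μ hg (hJ0pos q hq)
      have k3 : inner ℝ (z - ι x) (ι q) ≤ ‖z - ι x‖ * ‖ι q‖ := real_inner_le_norm _ _
      rw [inner_sub_left, k1] at k3
      have k4 : ‖ι q‖ ≤ ‖z - ι x‖ := by
        by_contra hcon
        push Not at hcon
        nlinarith [norm_nonneg (z - ι x)]
      have e : z - ι p = (z - ι x) - ι q := by
        rw [← hpq, map_sub]; abel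
      rw [e]
      refine (norm_sub_le _ _).trans_lt ?_
      linarith
  have hcore := crp_core μ hE J T1 C hJn hC hT1 hpos hone
  refine hcore.subset ?_
  rintro _ ⟨a, ha, rfl⟩
  have ha : ‖a‖ ≤ 1 := ha
  refine ⟨ι a, ⟨?_, ?_, ?_⟩, hT1e a⟩
  · have h1 : ‖ι a‖ ^ 2 ≤ 1 := by
      rw [hιn, hf]
      have h2 : ‖crpJ a a‖ ≤ 1 := by
        change ‖((crpJ a a : selfAdjoint A) : A)‖ ≤ 1
        rw [crpJ_self]
        exact (norm_mul_le _ _).trans (mul_le_one₀ ha (norm_nonneg _) ha)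
      calc ∫ ψ, ev (crpJ a a) ψ ∂μ ≤ ∫ ψ, (1 : ℝ) ∂μ :=
            integral_mono (crp_integrable μ _) (integrable_const _)
              (fun ψ => (le_abs_self _).trans ((hevn _ ψ).trans h2))
        _ = 1 := by simp
    nlinarith [norm_nonneg (ι a)]
  · rw [hJe, hJ0, ← crp_toLp_one, ← map_neg]
    exact crp_toLp_mono μ (fun ψ => (abs_le.1 ((hevn a ψ).trans ha)).1)
  · rw [hJe, hJ0, ← crp_toLp_one]
    exact crp_toLp_mono μ (fun ψ => (abs_le.1 ((hevn a ψ).trans ha)).2)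

lemma crp_compact {A : Type} [CStarAlgebra A]
    {E : Type*} [NormedAddCommGroup E] [NormedSpace ℂ E] [CompleteSpace E] (hE : HasCRP E)
    (T : A →L[ℂ] E) (hT : OneSumming T) : IsCompactOperator T := by
  letI : PartialOrder A := CStarAlgebra.spectralOrder A
  haveI : StarOrderedRing A := CStarAlgebra.spectralOrderedRing A
  rcases subsingleton_or_nontrivial A with hA | hA
  · have : (T : A → E) = (0 : A → E) := by
      ext x
      rw [Subsingleton.elim x 0, map_zero]
      rfl
    rw [this]
    exact isCompactOperator_zero
  have h := crp_main hE T hT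
  have hc := h.closure.isCompact_of_isClosed isClosed_closure
  set W := closure ((fun a : selfAdjoint A => T a) '' {a | ‖a‖ ≤ 1})
  rw [isCompactOperator_iff_exists_mem_nhds_image_subset_compact]
  refine ⟨Metric.closedBall 0 1, Metric.closedBall_mem_nhds _ one_pos,
    (fun p : E × E => p.1 + Complex.I • p.2) '' (W ×ˢ W), (hc.prod hc).image (by fun_prop), ?_⟩
  rintro _ ⟨x, hx, rfl⟩
  rw [mem_closedBall_zero_iff] at hx
  refine ⟨(T (realPart x : A), T (imaginaryPart x : A)), ⟨?_, ?_⟩, ?_⟩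
  · exact subset_closure ⟨realPart x, (realPart.norm_le x).trans hx, rfl⟩
  · exact subset_closure ⟨imaginaryPart x, (imaginaryPart.norm_le x).trans hx, rfl⟩
  · change T (realPart x : A) + Complex.I • T (imaginaryPart x : A) = T x
    rw [← map_smul, ← map_add, realPart_add_I_smul_imaginaryPart]

end PartNine

/-- For a Banach space `E` the following are equivalent:
(1) `E` has the compact range property;
(2) every `1`-summing operator `T : C[0,1] → E` is compact;
(3) for every C*-algebra `𝒜`, every `1`-summing operator `T : 𝒜 → E` is compact. -/
theorem hasCRP_tfae {E : Type*} [NormedAddCommGroup E] [NormedSpace ℂ E] [CompleteSpace E] :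
    List.TFAE
      [HasCRP E,
       ∀ T : C(Set.Icc (0:ℝ) 1, ℂ) →L[ℂ] E, OneSumming T → IsCompactOperator T,
       ∀ (A : Type) [NormedRing A] [StarRing A] [CStarRing A] [NormedAlgebra ℂ A]
         [CompleteSpace A] [StarModule ℂ A],
         ∀ T : A →L[ℂ] E, OneSumming T → IsCompactOperator T] := by
  tfae_have 2 → 1 := crpAux_two_one
  tfae_have 1 → 3 := by
    intro hE A _ _ _ _ _ _ T hT
    letI : CStarAlgebra A := {}
    exact crp_compact hE T hT
  tfae_have 3 → 2 := fun h T hT => h C(Set.Icc (0:ℝ) 1, ℂ) T hT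
  tfae_finish
end
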